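/- arXiv:0706.0157 — 7 statements merged into one kernel-verified Lean document; each statement's English description precedes it below -/
import Mathlib

section
/- Let F be a finite field with q elements. Let N₂(d) be the number of polynomials in F[x,y] of total degree exactly d, and I₂(d) the number of irreducible polynomials in F[x,y] of total degree exactly d. Then, as d → ∞, the sequence 1 − I₂(d)/N₂(d) is asymptotically equivalent to (q+1)/q^d. -/
open MvPolynomial Finset

namespace IrrProp

def S (d : ℕ) : ℕ := (d + 2).choose 2

lemma S_succ (d : ℕ) : S (d + 1) = S d + (d + 2) := by
  unfold S
  rw [show d + 1 + 2 = (d + 2) + 1 from rfl, Nat.choose_succ_succ' (d+2) 1]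
  simp; ring

lemma two_S (d : ℕ) : 2 * S d = (d + 1) * (d + 2) := by
  induction d with
  | zero => rfl
  | succ n ih => rw [S_succ, mul_add, ih]; ring

lemma sum_S (d : ℕ) : ∑ n ∈ Finset.range (d + 1), (n + 1) = S d := by
  induction d with
  | zero => rfl
  | succ n ih => rw [Finset.sum_range_succ, ih, S_succ]

lemma card_exps (d : ℕ) : Nat.card {s : Fin 2 →₀ ℕ | s.degree ≤ d} = S d := by
  have e : {s : Fin 2 →₀ ℕ | s.degree ≤ d} ≃ ((Finset.range (d+1)).sigma fun n => antidiagonal n) := 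
    { toFun := fun s => ⟨⟨s.1 0 + s.1 1, (s.1 0, s.1 1)⟩, by
        have := s.2
        simp [Finsupp.degree_eq_sum] at this
        simp; omega⟩
      invFun := fun x => ⟨Finsupp.equivFunOnFinite.symm ![x.1.2.1, x.1.2.2], by
        obtain ⟨⟨n, a, b⟩, h⟩ := x
        simp [Finsupp.degree_eq_sum] at h ⊢
        omega⟩
      left_inv := by
        intro s
        ext i
        fin_cases i <;> simp
      right_inv := by
        rintro ⟨⟨n, a, b⟩, h⟩
        simp at h
        obtain ⟨h1, rfl⟩ := h
        simp }
  rw [Nat.card_congr e]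
  simp only [Nat.card_eq_fintype_card, Fintype.card_coe, Finset.card_sigma, Finset.Nat.card_antidiagonal]
  exact sum_S d

set_option linter.unusedSectionVars false

variable (F : Type*) [Field F] [Fintype F]

lemma card_le (d : ℕ) : Nat.card (restrictTotalDegree (Fin 2) F d) = Fintype.card F ^ S d := by
  have h : Nat.card (restrictTotalDegree (Fin 2) F d) = Nat.card ({s : Fin 2 →₀ ℕ | s.degree ≤ d} →₀ F) :=
    Nat.card_congr (basisRestrictSupport F {s : Fin 2 →₀ ℕ | s.degree ≤ d}).repr.toEquiv
  have : Finite {s : Fin 2 →₀ ℕ | s.degree ≤ d} := by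
    apply Nat.finite_of_card_ne_zero
    rw [card_exps]
    have := two_S d
    intro h; rw [h] at this; simp at this
  rw [h, Nat.card_congr Finsupp.equivFunOnFinite, Nat.card_fun, card_exps, Nat.card_eq_fintype_card]

lemma ncard_le (d : ℕ) : {f : MvPolynomial (Fin 2) F | f.totalDegree ≤ d}.ncard = Fintype.card F ^ S d := by
  have : {f : MvPolynomial (Fin 2) F | f.totalDegree ≤ d} = (restrictTotalDegree (Fin 2) F d : Set _) := by
    ext f; simp [mem_restrictTotalDegree]
  rw [this, ← card_le, ← Nat.card_coe_set_eq]; rfl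

lemma finite_le (d : ℕ) : {f : MvPolynomial (Fin 2) F | f.totalDegree ≤ d}.Finite := by
  apply Set.finite_of_ncard_ne_zero
  rw [ncard_le]
  exact pow_ne_zero _ Fintype.card_ne_zero

lemma finite_eq (d : ℕ) : {f : MvPolynomial (Fin 2) F | f.totalDegree = d}.Finite :=
  (finite_le F d).subset fun _ h => le_of_eq h

/-- polynomials of degree exactly `d` -/
noncomputable def P (d : ℕ) : Finset (MvPolynomial (Fin 2) F) := (finite_eq F d).toFinset

lemma mem_P {d : ℕ} {f : MvPolynomial (Fin 2) F} : f ∈ P F d ↔ f.totalDegree = d := by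
  simp [P]

lemma card_P_succ (d : ℕ) :
    #(P F (d+1)) + Fintype.card F ^ S d = Fintype.card F ^ S (d+1) := by
  rw [← ncard_le F d, ← ncard_le F (d+1), P, ← Set.ncard_eq_toFinset_card _ (finite_eq F (d+1)),
    ← Set.ncard_union_eq _ (finite_eq F _) (finite_le F _)]
  · congr 1
    ext f
    simp
    omega
  · rw [Set.disjoint_left]
    intro f h1 h2
    simp at h1 h2
    omega

lemma card_P_le (d : ℕ) : #(P F d) ≤ Fintype.card F ^ S d := by
  rw [← ncard_le F d, P, ← Set.ncard_eq_toFinset_card _ (finite_eq F d)]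
  exact Set.ncard_le_ncard (fun _ h => le_of_eq h) (finite_le F _)

lemma ne_zero_of_mem {d : ℕ} (hd : d ≠ 0) {f : MvPolynomial (Fin 2) F} (h : f ∈ P F d) : f ≠ 0 := by
  rintro rfl
  rw [mem_P] at h
  simp at h
  omega

lemma not_isUnit_of_mem {d : ℕ} (hd : d ≠ 0) {f : MvPolynomial (Fin 2) F} (h : f ∈ P F d) :
    ¬ IsUnit f := by
  rw [mem_P] at h
  intro hu
  rw [isUnit_iff_totalDegree_of_isReduced] at hu
  omega

lemma isUnit_of_deg {f : MvPolynomial (Fin 2) F} (h0 : f ≠ 0) (h : f.totalDegree = 0) :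
    IsUnit f := by
  rw [isUnit_iff_totalDegree_of_isReduced]
  refine ⟨?_, h⟩
  rw [totalDegree_eq_zero_iff_eq_C] at h
  rw [isUnit_iff_ne_zero]
  intro h'
  rw [h', map_zero] at h
  exact h0 h

lemma mul_mem {a b : ℕ} (ha : a ≠ 0) (hb : b ≠ 0) {f g : MvPolynomial (Fin 2) F}
    (hf : f ∈ P F a) (hg : g ∈ P F b) : f * g ∈ P F (a + b) := by
  have h1 := ne_zero_of_mem F ha hf
  have h2 := ne_zero_of_mem F hb hg
  rw [mem_P] at *
  rw [totalDegree_mul_of_isDomain h1 h2, hf, hg]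

lemma C_mul_mem {a : ℕ} (ha : a ≠ 0) (c : Fˣ) {f : MvPolynomial (Fin 2) F}
    (hf : f ∈ P F a) : C (c : F) * f ∈ P F a := by
  have h1 := ne_zero_of_mem F ha hf
  rw [mem_P] at *
  rw [totalDegree_mul_of_isDomain (by simp) h1, hf, totalDegree_C, zero_add]

lemma irr_one {f : MvPolynomial (Fin 2) F} (h : f ∈ P F 1) : Irreducible f := by
  refine ⟨not_isUnit_of_mem F one_ne_zero h, ?_⟩
  rintro a b rfl
  have h0 := ne_zero_of_mem F one_ne_zero h
  have ha := left_ne_zero_of_mul h0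
  have hb := right_ne_zero_of_mul h0
  rw [mem_P, totalDegree_mul_of_isDomain ha hb] at h
  rcases Nat.eq_zero_or_pos a.totalDegree with h' | h'
  · exact Or.inl (isUnit_of_deg F ha h')
  · exact Or.inr (isUnit_of_deg F hb (by omega))

open scoped Classical in
/-- reducible polynomials of degree exactly `d` -/
noncomputable def R (d : ℕ) : Finset (MvPolynomial (Fin 2) F) := {f ∈ P F d | ¬ Irreducible f}

lemma mem_R {d : ℕ} (hd : d ≠ 0) {f : MvPolynomial (Fin 2) F} (h : f ∈ R F d) :
    ∃ a b, a ≠ 0 ∧ b ≠ 0 ∧ a ≤ b ∧ a + b = d ∧ ∃ g ∈ P F a, ∃ h ∈ P F b, g * h = f := by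
  classical
  simp only [R, mem_filter] at h
  obtain ⟨h1, h2⟩ := h
  have h0 := ne_zero_of_mem F hd h1
  rw [irreducible_iff] at h2
  push Not at h2
  obtain ⟨a, b, rfl, ha, hb⟩ := h2 (not_isUnit_of_mem F hd h1)
  have ha0 := left_ne_zero_of_mul h0
  have hb0 := right_ne_zero_of_mul h0
  rw [mem_P, totalDegree_mul_of_isDomain ha0 hb0] at h1
  have ha' : a.totalDegree ≠ 0 := fun h => ha (isUnit_of_deg F ha0 h)
  have hb' : b.totalDegree ≠ 0 := fun h => hb (isUnit_of_deg F hb0 h)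
  rcases le_total a.totalDegree b.totalDegree with h | h
  · exact ⟨_, _, ha', hb', h, h1, a, (mem_P F).2 rfl, b, (mem_P F).2 rfl, rfl⟩
  · exact ⟨_, _, hb', ha', h, by omega, b, (mem_P F).2 rfl, a, (mem_P F).2 rfl, mul_comm _ _⟩

lemma mul_mem_R {a b : ℕ} (ha : a ≠ 0) (hb : b ≠ 0) {f g : MvPolynomial (Fin 2) F}
    (hf : f ∈ P F a) (hg : g ∈ P F b) : f * g ∈ R F (a + b) := by
  classical
  simp only [R, mem_filter]
  refine ⟨mul_mem F ha hb hf hg, fun h => ?_⟩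
  rcases h.isUnit_or_isUnit rfl with h | h
  · exact not_isUnit_of_mem F ha hf h
  · exact not_isUnit_of_mem F hb hg h

open scoped Classical in
/-- products of a polynomial of degree `a` and a polynomial of degree `b` -/
noncomputable def prods (a b : ℕ) : Finset (MvPolynomial (Fin 2) F) :=
  (P F a ×ˢ P F b).image fun p => p.1 * p.2

open scoped Classical in
lemma card_units : Fintype.card Fˣ = Fintype.card F - 1 := by
  exact Fintype.card_units F

open scoped Classical in
lemma prods_one_le (b : ℕ) (hb : b ≠ 0) :
    (Fintype.card F - 1) * #(prods F 1 b) ≤ #(P F 1) * #(P F b) := by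
  rw [← card_product]
  apply mul_card_image_le_card
  intro f hf
  simp only [mem_image, mem_product] at hf
  obtain ⟨⟨l, h⟩, ⟨hl, hh⟩, rfl⟩ := hf
  simp only at hl hh ⊢
  rw [← card_units F, ← Finset.card_univ]
  apply Finset.card_le_card_of_injOn (fun c : Fˣ => (C (c : F) * l, C ((c⁻¹ : Fˣ) : F) * h))
  · intro c _
    simp only [coe_filter, mem_product, Set.mem_ofPred_eq]
    refine ⟨⟨C_mul_mem F one_ne_zero c hl, C_mul_mem F hb _ hh⟩, ?_⟩
    have : (C (c : F) * C ((c⁻¹ : Fˣ) : F) : MvPolynomial (Fin 2) F) = 1 := by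
      rw [← C_mul]; simp
    linear_combination (l * h) * this
  · intro c _ c' _ hcc
    simp only [Prod.mk.injEq] at hcc
    have := mul_right_cancel₀ (ne_zero_of_mem F one_ne_zero hl) hcc.1
    exact Units.ext (C_injective _ _ this)

open scoped Classical in
lemma R_one_ge (b : ℕ) (hb : b ≠ 0) :
    #(P F 1) * #(P F (b + 1)) ≤
      (Fintype.card F - 1) * #(R F (b + 2)) + #(P F 1) * (#(P F 1) * #(P F b)) := by
  set A := P F 1 ×ˢ P F (b+1) with hA
  set B := (P F 1 ×ˢ (P F 1 ×ˢ P F b)).image (fun p => (p.1, p.2.1 * p.2.2)) with hB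
  have h1 : #A ≤ #(A \ B) + #B := by
    have := Finset.le_card_sdiff B A
    omega
  have h2 : #B ≤ #(P F 1) * (#(P F 1) * #(P F b)) := by
    rw [← card_product, ← card_product]
    exact card_image_le
  have h3 : #(A \ B) ≤ (Fintype.card F - 1) * #(R F (b + 2)) := by
    apply card_le_mul_card_image_of_maps_to (f := fun p => p.1 * p.2)
    · rintro ⟨l, h⟩ hp
      simp only [mem_sdiff, hA, mem_product] at hp
      have := mul_mem_R F one_ne_zero (by omega) hp.1.1 hp.1.2
      rwa [show 1 + (b + 1) = b + 2 by omega] at this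
    · intro f _
      rcases Finset.eq_empty_or_nonempty {p ∈ A \ B | p.1 * p.2 = f} with he | ⟨⟨l, h⟩, hne⟩
      · rw [he]; simp
      · simp only [mem_filter, mem_sdiff, hA, mem_product] at hne
        obtain ⟨⟨⟨hl, hh⟩, hnB⟩, rfl⟩ := hne
        rw [← card_units F, ← Finset.card_univ]
        apply Finset.card_le_card_of_surjOn (fun c : Fˣ => (C (c : F) * l, C ((c⁻¹ : Fˣ) : F) * h))
        rintro ⟨l', h'⟩ hp
        simp only [coe_filter, Set.mem_ofPred_eq, mem_sdiff, hA, mem_product] at hp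
        obtain ⟨⟨⟨hl', hh'⟩, -⟩, he⟩ := hp
        have hl0 := ne_zero_of_mem F one_ne_zero hl
        have hl0' := ne_zero_of_mem F one_ne_zero hl'
        have hh0 := ne_zero_of_mem F (by omega) hh
        have hpr : Prime l' := (irr_one F hl').prime
        have hdvd : l' ∣ l * h := ⟨h', he.symm⟩
        have hd : l' ∣ l := by
          rcases hpr.dvd_or_dvd hdvd with h | ⟨m, rfl⟩
          · exact h
          · exfalso
            apply hnB
            rw [hB, mem_image]
            refine ⟨(l, l', m), ?_, rfl⟩
            simp only [mem_product]
            refine ⟨hl, hl', ?_⟩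
            rw [mem_P] at *
            rw [totalDegree_mul_of_isDomain hl0' (right_ne_zero_of_mul hh0)] at hh
            omega
        obtain ⟨u, hu⟩ := ((irr_one F hl').associated_of_dvd (irr_one F hl) hd).symm
        obtain ⟨c, hc, hc'⟩ := isUnit_iff_eq_C_of_isReduced.1 u.isUnit
        obtain ⟨c, rfl⟩ := hc
        rw [hc'] at hu
        have hcc : (C (c : F) * C ((c⁻¹ : Fˣ) : F) : MvPolynomial (Fin 2) F) = 1 := by
          rw [← C_mul]; simp
        refine ⟨c, by simp, ?_⟩
        subst hu
        simp only [Prod.mk.injEq]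
        refine ⟨mul_comm _ _, ?_⟩
        apply mul_left_cancel₀ hl0
        linear_combination (-C ((c⁻¹ : Fˣ) : F)) * he + (l * h') * hcc
  rw [← card_product]
  exact h1.trans (add_le_add h3 h2)

open scoped Classical in
lemma R_le (d : ℕ) (hd : 4 ≤ d) :
    #(R F d) ≤ #(prods F 1 (d-1)) + ∑ k ∈ Icc 2 (d-2), #(P F k) * #(P F (d-k)) := by
  have hsub : R F d ⊆ prods F 1 (d-1) ∪ (Icc 2 (d-2)).biUnion (fun k => prods F k (d-k)) := by
    intro f hf
    obtain ⟨a, b, ha, hb, hab, rfl, g, hg, h, hh, rfl⟩ := mem_R F (by omega) hf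
    rw [mem_union]
    rcases Nat.lt_or_ge a 2 with h2 | h2
    · left
      obtain rfl : a = 1 := by omega
      simp only [prods, mem_image, mem_product]
      exact ⟨(g, h), ⟨hg, by simpa using hh⟩, rfl⟩
    · right
      simp only [prods, mem_image, mem_product, mem_biUnion, mem_Icc]
      exact ⟨a, by omega, (g, h), ⟨hg, by simpa using hh⟩, rfl⟩
  refine (card_le_card hsub).trans ((card_union_le _ _).trans ?_)
  gcongr
  refine card_biUnion_le.trans (sum_le_sum fun k _ => ?_)
  rw [← card_product]
  exact card_image_le

lemma S_ineq (a b : ℕ) (ha : 2 ≤ a) (hb : 2 ≤ b) : S a + S b + 2 * (a + b) ≤ S (a + b) + 5 := by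
  have h1 := two_S a
  have h2 := two_S b
  have h3 := two_S (a + b)
  obtain ⟨a, rfl⟩ := Nat.exists_eq_add_of_le ha
  obtain ⟨b, rfl⟩ := Nat.exists_eq_add_of_le hb
  nlinarith [Nat.zero_le (a * b)]

lemma sum_le (d : ℕ) :
    (∑ k ∈ Icc 2 (d-2), #(P F k) * #(P F (d-k))) * Fintype.card F ^ (2 * d)
      ≤ d * Fintype.card F ^ (S d + 5) := by
  rw [sum_mul]
  have : ∀ k ∈ Icc 2 (d-2), #(P F k) * #(P F (d-k)) * Fintype.card F ^ (2 * d)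
      ≤ Fintype.card F ^ (S d + 5) := by
    intro k hk
    rw [mem_Icc] at hk
    obtain ⟨b, rfl⟩ := Nat.exists_eq_add_of_le (show k ≤ d by omega)
    simp only [add_tsub_cancel_left]
    calc _ ≤ Fintype.card F ^ S k * Fintype.card F ^ S b * Fintype.card F ^ (2 * (k + b)) := by
          gcongr <;> apply card_P_le
      _ = Fintype.card F ^ (S k + S b + 2 * (k + b)) := by rw [pow_add, pow_add]
      _ ≤ _ := Nat.pow_le_pow_right Fintype.card_pos (S_ineq k b (by omega) (by omega))
  refine (sum_le_card_nsmul _ _ _ this).trans ?_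
  rw [smul_eq_mul]
  gcongr
  simp
  omega

lemma alg_low (Q t m R N1 N2 N3 N4 : ℝ) (hQ : 2 ≤ Q) (ht : 1 ≤ t) (hm : 0 < m)
    (h1 : N1 = Q ^ 3 - Q) (h2 : N2 ≤ m) (h3 : N3 = m * (t * Q ^ 4 - 1))
    (h4 : N4 = m * (t * Q ^ 4) * (t * Q ^ 5 - 1))
    (h : N1 * N3 ≤ (Q - 1) * R + N1 * (N1 * N2)) :
    (Q ^ 5 - Q * (1 + Q ^ 3 - Q) * t⁻¹) / (Q ^ 5 - t⁻¹) ≤ R / N4 / ((Q + 1) / (t * Q ^ 4)) := by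
  have hQ5 : 1 < t * Q ^ 5 := by
    have : (2:ℝ) ^ 5 ≤ Q ^ 5 := by gcongr
    nlinarith
  have hp : 0 < t * Q ^ 5 - 1 := by linarith
  have ht0 : 0 < t := by linarith
  have hQ0 : 0 < Q := by linarith
  have hN1 : 0 ≤ N1 := by rw [h1]; nlinarith [mul_pos hQ0 hQ0, mul_self_nonneg (Q-2)]
  have e1 : (Q ^ 5 - Q * (1 + Q ^ 3 - Q) * t⁻¹) / (Q ^ 5 - t⁻¹)
      = (Q * (t * Q ^ 4 - 1 - Q ^ 3 + Q)) / (t * Q ^ 5 - 1) := by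
    have : Q ^ 5 - t⁻¹ = (t * Q ^ 5 - 1) / t := by field_simp
    rw [this]
    field_simp
    ring
  have e2 : R / N4 / ((Q + 1) / (t * Q ^ 4)) = (R / (m * (Q + 1))) / (t * Q ^ 5 - 1) := by
    rw [h4]
    field_simp
  rw [e1, e2]
  gcongr
  rw [le_div_iff₀ (by positivity)]
  have h' : N1 * (N1 * N2) ≤ N1 * (N1 * m) := by gcongr
  have hQ1 : 0 < Q - 1 := by linarith
  refine le_of_mul_le_mul_left ?_ hQ1
  subst h1 h3
  nlinarith

lemma alg_up (Q t m R T c N1 N3 N4 : ℝ) (hQ : 2 ≤ Q) (ht : 1 ≤ t) (hm : 0 < m)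
    (h1 : N1 = Q ^ 3 - Q) (h3 : N3 = m * (t * Q ^ 4 - 1))
    (h4 : N4 = m * (t * Q ^ 4) * (t * Q ^ 5 - 1))
    (h : (Q - 1) * R ≤ N1 * N3 + (Q - 1) * T)
    (hT : T * (t ^ 2 * Q ^ 8) ≤ c * (m * (t * Q ^ 4) * (t * Q ^ 5) * Q ^ 5)) :
    R / N4 / ((Q + 1) / (t * Q ^ 4)) ≤
      (Q ^ 5 - Q * t⁻¹) / (Q ^ 5 - t⁻¹) + (c * t⁻¹) * Q ^ 6 / ((Q ^ 5 - t⁻¹) * (Q + 1)) := by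
  have hQ5 : 1 < t * Q ^ 5 := by
    have : (2:ℝ) ^ 5 ≤ Q ^ 5 := by gcongr
    nlinarith
  have hp : 0 < t * Q ^ 5 - 1 := by linarith
  have ht0 : 0 < t := by linarith
  have hQ0 : 0 < Q := by linarith
  have hT' : T ≤ c * m * Q ^ 6 := by
    refine le_of_mul_le_mul_right ?_ (show 0 < t ^ 2 * Q ^ 8 by positivity)
    refine hT.trans (le_of_eq (by ring))
  have e1 : (Q ^ 5 - Q * t⁻¹) / (Q ^ 5 - t⁻¹) + (c * t⁻¹) * Q ^ 6 / ((Q ^ 5 - t⁻¹) * (Q + 1))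
      = (Q * (t * Q ^ 4 - 1) + c * Q ^ 6 / (Q + 1)) / (t * Q ^ 5 - 1) := by
    have : Q ^ 5 - t⁻¹ = (t * Q ^ 5 - 1) / t := by field_simp
    rw [this]
    field_simp
  have e2 : R / N4 / ((Q + 1) / (t * Q ^ 4)) = (R / (m * (Q + 1))) / (t * Q ^ 5 - 1) := by
    rw [h4]
    field_simp
  rw [e1, e2]
  gcongr
  rw [div_le_iff₀ (by positivity)]
  have e3 : (Q * (t * Q ^ 4 - 1) + c * Q ^ 6 / (Q + 1)) * (m * (Q + 1))
      = Q * (t * Q ^ 4 - 1) * (m * (Q + 1)) + c * m * Q ^ 6 := by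
    field_simp
  rw [e3]
  have hQ1 : 0 < Q - 1 := by linarith
  have h5 := mul_le_mul_of_nonneg_left hT' hQ1.le
  refine le_of_mul_le_mul_left ?_ hQ1
  subst h1 h3
  linarith

end IrrProp

open IrrProp in
/-- For a finite field `F` with `q` elements, with `N d` the number of
polynomials in `F[x,y]` of total degree exactly `d` and `I d` the number of irreducible
ones, `1 - I d / N d ~ (q+1)/q^d` as `d → ∞`. -/
theorem irreducible_proportion_two_vars (F : Type*) [Field F] [Fintype F]
    (q : ℕ) (hq : q = Fintype.card F)
    (N I : ℕ → ℕ)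
    (hN : ∀ d, N d = Set.ncard {f : MvPolynomial (Fin 2) F | f.totalDegree = d})
    (hI : ∀ d, I d = Set.ncard
      {f : MvPolynomial (Fin 2) F | f.totalDegree = d ∧ Irreducible f}) :
    Asymptotics.IsEquivalent Filter.atTop
      (fun d : ℕ => 1 - (I d : ℝ) / (N d : ℝ))
      (fun d : ℕ => ((q : ℝ) + 1) / (q : ℝ) ^ d) := by
  classical
  have hq2 : 2 ≤ q := by
    rw [hq]; exact Fintype.one_lt_card
  have hQ : (2:ℝ) ≤ (q:ℝ) := by exact_mod_cast hq2
  have hQ0 : (0:ℝ) < q := by linarith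
  have hNP : ∀ d, N d = #(P F d) := fun d => by
    rw [hN, P, ← Set.ncard_eq_toFinset_card _ (finite_eq F d)]
  have hIR : ∀ d, I d + #(R F d) = N d := fun d => by
    have : I d = #{f ∈ P F d | Irreducible f} := by
      rw [hI, ← Set.ncard_coe_finset]
      congr 1
      ext f
      simp [mem_P]
    rw [this, hNP, IrrProp.R, Finset.card_filter_add_card_filter_not]
  rw [Asymptotics.isEquivalent_iff_tendsto_one (Filter.Eventually.of_forall fun d => by positivity),
    ← Filter.tendsto_add_atTop_iff_nat 4]
  have hr : Filter.Tendsto (fun n : ℕ => ((q:ℝ) ^ n)⁻¹) Filter.atTop (nhds 0) := by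
    simp_rw [← inv_pow]
    exact tendsto_pow_atTop_nhds_zero_of_lt_one (by positivity) (inv_lt_one_of_one_lt₀ (by linarith))
  have hnr : Filter.Tendsto (fun n : ℕ => ((n + 4 : ℕ) : ℝ) * ((q:ℝ) ^ n)⁻¹) Filter.atTop (nhds 0) := by
    have h1 := tendsto_self_mul_const_pow_of_lt_one (r := (q:ℝ)⁻¹) (by positivity)
      (inv_lt_one_of_one_lt₀ (by linarith))
    have h2 := h1.add (hr.const_mul 4)
    simp only [mul_zero, add_zero] at h2
    refine h2.congr fun n => ?_
    rw [inv_pow]; push_cast; ring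
  have hMs : ∀ d, (q:ℝ) ^ S (d+1) = (q:ℝ) ^ S d * (q:ℝ) ^ (d+2) := fun d => by
    rw [S_succ, pow_add]
  have hPs : ∀ d, (#(P F (d+1)) : ℝ) = (q:ℝ) ^ S (d+1) - (q:ℝ) ^ S d := fun d => by
    have := card_P_succ F d
    rw [← hq] at this
    rw [eq_sub_iff_add_eq]
    exact_mod_cast this
  have hP1 : (#(P F 1) : ℝ) = (q:ℝ) ^ 3 - q := by
    rw [hPs 0]
    simp [S, Nat.choose]
  have hP3 : ∀ n, (#(P F (n+3)) : ℝ) = (q:ℝ) ^ S (n+2) * ((q:ℝ) ^ n * (q:ℝ) ^ 4 - 1) := fun n => by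
    rw [hPs (n+2), hMs (n+2)]; ring
  have hP4 : ∀ n, (#(P F (n+4)) : ℝ) =
      (q:ℝ) ^ S (n+2) * ((q:ℝ) ^ n * (q:ℝ) ^ 4) * ((q:ℝ) ^ n * (q:ℝ) ^ 5 - 1) := fun n => by
    rw [hPs (n+3), hMs (n+3), hMs (n+2)]; ring
  have hrat : ∀ n : ℕ, ((fun d : ℕ => 1 - (I d : ℝ) / (N d : ℝ)) /
      (fun d : ℕ => ((q : ℝ) + 1) / (q : ℝ) ^ d)) (n + 4)
      = (#(R F (n+4)) : ℝ) / (#(P F (n+4)) : ℝ) / (((q:ℝ) + 1) / ((q:ℝ) ^ n * (q:ℝ)^4)) := fun n => by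
    simp only [Pi.div_apply]
    rw [← pow_add]
    congr 1
    have h := hIR (n+4)
    have h0 : (N (n+4) : ℝ) ≠ 0 := by
      rw [hNP, hP4]
      have : (1:ℝ) < (q:ℝ) ^ n * (q:ℝ) ^ 5 := by
        rw [← pow_add]
        exact one_lt_pow₀ (by linarith) (by omega)
      have : 0 < (q:ℝ) ^ n * (q:ℝ) ^ 5 - 1 := by linarith
      positivity
    rw [← hNP, eq_div_iff h0, sub_mul, div_mul_cancel₀ _ h0, ← h]
    push_cast
    ring
  have hq1 : ((Fintype.card F - 1 : ℕ) : ℝ) = (q:ℝ) - 1 := by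
    rw [← hq]
    push_cast [Nat.cast_sub (show 1 ≤ q by omega)]
    ring
  have hlow : ∀ n : ℕ, ((q:ℝ) ^ 5 - q * (1 + (q:ℝ) ^ 3 - q) * ((q:ℝ)^n)⁻¹) / ((q:ℝ) ^ 5 - ((q:ℝ)^n)⁻¹) ≤
      ((fun d : ℕ => 1 - (I d : ℝ) / (N d : ℝ)) /
      (fun d : ℕ => ((q : ℝ) + 1) / (q : ℝ) ^ d)) (n + 4) := fun n => by
    rw [hrat]
    refine alg_low q (q ^ n) (q ^ S (n+2)) _ (#(P F 1)) (#(P F (n+2))) (#(P F (n+3))) _ hQ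
      (one_le_pow₀ (by linarith)) (by positivity) hP1 ?_ (hP3 n) (hP4 n) ?_
    · have := card_P_le F (n+2)
      rw [← hq] at this
      exact_mod_cast this
    · have := R_one_ge F (n+2) (by omega)
      rw [← hq1]
      exact_mod_cast this
  have hup : ∀ n : ℕ, ((fun d : ℕ => 1 - (I d : ℝ) / (N d : ℝ)) /
      (fun d : ℕ => ((q : ℝ) + 1) / (q : ℝ) ^ d)) (n + 4) ≤
      ((q:ℝ) ^ 5 - q * ((q:ℝ)^n)⁻¹) / ((q:ℝ) ^ 5 - ((q:ℝ)^n)⁻¹)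
      + (((n + 4 : ℕ) : ℝ) * ((q:ℝ)^n)⁻¹) * (q:ℝ) ^ 6 / (((q:ℝ) ^ 5 - ((q:ℝ)^n)⁻¹) * (q + 1)) := fun n => by
    rw [hrat]
    refine alg_up q (q ^ n) (q ^ S (n+2)) _
      ((∑ k ∈ Finset.Icc 2 (n+4-2), #(P F k) * #(P F (n+4-k)) : ℕ) : ℝ) _
      (#(P F 1)) (#(P F (n+3))) _ hQ
      (one_le_pow₀ (by linarith)) (by positivity) hP1 (hP3 n) (hP4 n) ?_ ?_
    · have h1 := prods_one_le F (n+3) (by omega)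
      have h2 := R_le F (n+4) (by omega)
      have h3 := Nat.mul_le_mul_left (Fintype.card F - 1) h2
      rw [mul_add] at h3
      have h4 := h3.trans (Nat.add_le_add_right h1 _)
      rw [← hq1]
      exact_mod_cast h4
    · have h1 := sum_le F (n+4)
      rw [← hq] at h1
      have h2 : ((∑ k ∈ Finset.Icc 2 (n+4-2), #(P F k) * #(P F (n+4-k)) : ℕ) : ℝ) * (q:ℝ) ^ (2 * (n+4))
        ≤ ((n+4 : ℕ) : ℝ) * (q:ℝ) ^ (S (n+4) + 5) := by exact_mod_cast h1
      rw [pow_add, hMs (n+3), hMs (n+2)] at h2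
      convert h2 using 1 <;> ring
  have hden : Filter.Tendsto (fun n : ℕ => (q:ℝ) ^ 5 - ((q:ℝ)^n)⁻¹) Filter.atTop (nhds ((q:ℝ)^5)) := by
    simpa using hr.const_sub ((q:ℝ)^5)
  have hq5 : (q:ℝ)^5 ≠ 0 := by positivity
  refine tendsto_of_tendsto_of_tendsto_of_le_of_le ?_ ?_ hlow hup
  · have := ((hr.const_mul ((q:ℝ) * (1 + (q:ℝ) ^ 3 - q))).const_sub ((q:ℝ)^5)).div hden hq5
    rw [mul_zero, sub_zero, div_self hq5] at this
    exact this
  · have h1 := ((hr.const_mul (q:ℝ)).const_sub ((q:ℝ)^5)).div hden hq5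
    have h2 := (hnr.mul_const ((q:ℝ)^6)).div (hden.mul_const ((q:ℝ) + 1)) (by positivity)
    have h3 := h1.add h2
    rw [mul_zero, sub_zero, div_self hq5, zero_mul, zero_div, add_zero] at h3
    exact h3
end

section
/- Let F be a finite field with q elements. Let N₂(d) be the number of polynomials in F[x,y] of total degree exactly d, and I₂(d) the number of irreducible polynomials in F[x,y] of total degree exactly d. Then I₂(d)/N₂(d) → 1 as d → ∞; that is, almost all polynomials in two variables over F are irreducible. -/
namespace AlmostAllIrr

open MvPolynomial

/-- The number of monomials in two variables of degree at most `m`. -/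
def B (m : ℕ) : ℕ := ∑ i ∈ Finset.range (m + 1), (i + 1)

theorem two_B (m : ℕ) : 2 * B m = (m + 1) * (m + 2) := by
  induction m with
  | zero => simp [B]
  | succ k ih =>
    have : B (k + 1) = B k + (k + 1 + 1) := by
      unfold B
      rw [Finset.sum_range_succ]
    rw [this]
    nlinarith

theorem B_key (a b : ℕ) (ha : 1 ≤ a) (hb : 1 ≤ b) : B a + B b + (a + b) ≤ B (a + b) + 2 := by
  have h1 := two_B a
  have h2 := two_B b
  have h3 := two_B (a + b)
  obtain ⟨a, rfl⟩ := Nat.exists_eq_add_of_le ha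
  obtain ⟨b, rfl⟩ := Nat.exists_eq_add_of_le hb
  nlinarith [Nat.zero_le (a * b)]

theorem card_mono (m : ℕ) :
    Set.ncard {n : Fin 2 →₀ ℕ | (n.sum fun _ e => e) ≤ m} = B m := by
  classical
  let g : (Σ _ : ℕ, ℕ × ℕ) → (Fin 2 →₀ ℕ) :=
    fun p => Finsupp.equivFunOnFinite.symm ![p.2.1, p.2.2]
  have himg : {n : Fin 2 →₀ ℕ | (n.sum fun _ e => e) ≤ m} =
      (((Finset.range (m + 1)).sigma fun i => Finset.HasAntidiagonal.antidiagonal i).image g : Finset _) := by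
    ext n
    simp only [Set.mem_ofPred_eq, Finset.coe_image, Set.mem_image, Finset.mem_coe,
      Finset.mem_sigma, Finset.mem_range, Finset.HasAntidiagonal.mem_antidiagonal]
    have hs : (n.sum fun _ e => e) = n 0 + n 1 := by
      rw [Finsupp.sum_fintype _ _ (by simp)]
      simp
    rw [hs]
    constructor
    · intro h
      refine ⟨⟨n 0 + n 1, (n 0, n 1)⟩, ⟨by simpa using Nat.lt_succ_of_le h, rfl⟩, ?_⟩
      ext i
      fin_cases i <;> simp [g]
    · rintro ⟨⟨k, a, b⟩, ⟨h1, h2⟩, rfl⟩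
      simp [g] at *
      omega
  rw [himg, Set.ncard_coe_finset, Finset.card_image_of_injOn, Finset.card_sigma]
  · simp [B]
  · rintro ⟨k, a, b⟩ h1 ⟨k', a', b'⟩ h2 h
    simp at h1 h2
    have e0 := DFunLike.congr_fun h 0
    have e1 := DFunLike.congr_fun h 1
    simp [g] at e0 e1
    obtain ⟨-, rfl⟩ := h1
    obtain ⟨-, rfl⟩ := h2
    subst e0 e1
    rfl

variable (F : Type*) [Field F] [Fintype F]

/-- The polynomials of total degree at most `m`. -/
def A (m : ℕ) : Set (MvPolynomial (Fin 2) F) := {f | f.totalDegree ≤ m}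

theorem A_eq (m : ℕ) : A F m = (restrictTotalDegree (Fin 2) F m : Set _) := by
  ext f
  simp [A, mem_restrictTotalDegree]

theorem A_finite (m : ℕ) : (A F m).Finite := by
  rw [A_eq]
  have : Finite (restrictTotalDegree (Fin 2) F m) := Module.finite_of_finite F
  exact Set.toFinite _

theorem A_card (m : ℕ) : (A F m).ncard = Fintype.card F ^ B m := by
  rw [A_eq, ← Nat.card_coe_set_eq]
  have h := Module.natCard_eq_pow_finrank (K := F) (V := restrictTotalDegree (Fin 2) F m)
  have hb : Module.finrank F (restrictTotalDegree (Fin 2) F m) = B m := by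
    have := Module.finrank_eq_nat_card_basis
      (basisRestrictSupport F {n : Fin 2 →₀ ℕ | (n.sum fun _ e => e) ≤ m})
    rw [Nat.card_coe_set_eq, card_mono] at this
    exact this
  rw [hb, Nat.card_eq_fintype_card (α := F)] at h
  exact h

theorem N_lower (d : ℕ) (hd : 1 ≤ d) :
    Fintype.card F ^ B d ≤ 2 * Set.ncard {f : MvPolynomial (Fin 2) F | f.totalDegree = d} := by
  obtain ⟨k, rfl⟩ := Nat.exists_eq_add_of_le' hd
  have hsub : A F (k + 1) ⊆ {f : MvPolynomial (Fin 2) F | f.totalDegree = k + 1} ∪ A F k := by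
    intro f hf
    simp only [A, Set.mem_ofPred_eq, Set.mem_union] at *
    omega
  have hfin : {f : MvPolynomial (Fin 2) F | f.totalDegree = k + 1}.Finite :=
    (A_finite F (k + 1)).subset (fun f hf => le_of_eq hf)
  have h1 := (Set.ncard_le_ncard hsub (hfin.union (A_finite F k))).trans (Set.ncard_union_le _ _)
  rw [A_card, A_card] at h1
  have hB : B (k + 1) = B k + (k + 1) + 1 := by
    unfold B
    rw [Finset.sum_range_succ]
    ring
  have hq : 2 ≤ Fintype.card F := Fintype.one_lt_card
  have h2 : 2 * Fintype.card F ^ B k ≤ Fintype.card F ^ B (k + 1) := by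
    calc 2 * Fintype.card F ^ B k ≤ Fintype.card F * Fintype.card F ^ B k := by gcongr
      _ = Fintype.card F ^ (B k + 1) := by ring
      _ ≤ _ := Nat.pow_le_pow_right (by omega) (by omega)
  omega

theorem R_upper (d : ℕ) (hd : 1 ≤ d) :
    Set.ncard {f : MvPolynomial (Fin 2) F | f.totalDegree = d ∧ ¬ Irreducible f} *
      Fintype.card F ^ d ≤ d * Fintype.card F ^ (B d + 2) := by
  have unit_of : ∀ g : MvPolynomial (Fin 2) F, g ≠ 0 → g.totalDegree = 0 → IsUnit g := by
    intro g hg h0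
    rw [totalDegree_eq_zero_iff_eq_C] at h0
    rw [h0]
    refine IsUnit.map C (IsUnit.mk0 _ ?_)
    intro h
    rw [h, map_zero] at h0
    exact hg h0
  let S : ℕ → Set (MvPolynomial (Fin 2) F) := fun a =>
    Set.image (fun p : MvPolynomial (Fin 2) F × MvPolynomial (Fin 2) F => p.1 * p.2)
      (A F a ×ˢ A F (d - a))
  have hSfin : ∀ a, (S a).Finite := fun a => ((A_finite F _).prod (A_finite F _)).image _
  have hsub : {f : MvPolynomial (Fin 2) F | f.totalDegree = d ∧ ¬ Irreducible f} ⊆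
      ⋃ a ∈ Finset.Ico 1 d, S a := by
    rintro f ⟨hf, hirr⟩
    have hf0 : f ≠ 0 := by
      rintro rfl
      simp at hf
      omega
    have hfu : ¬ IsUnit f := by
      intro h
      have := (isUnit_iff_totalDegree_of_isReduced.mp h).2
      omega
    rw [irreducible_iff] at hirr
    push Not at hirr
    obtain ⟨g, h, rfl, hg, hh⟩ := hirr hfu
    have hg0 := left_ne_zero_of_mul hf0
    have hh0 := right_ne_zero_of_mul hf0
    rw [totalDegree_mul_of_isDomain hg0 hh0] at hf
    have h1 : g.totalDegree ≠ 0 := fun h => hg (unit_of _ hg0 h)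
    have h2 : h.totalDegree ≠ 0 := fun e => hh (unit_of _ hh0 e)
    simp only [Set.mem_iUnion]
    refine ⟨g.totalDegree, by simp; omega, (g, h), ⟨?_, ?_⟩, rfl⟩
    · simp [A]
    · simp [A]; omega
  have hfin : (⋃ a ∈ Finset.Ico 1 d, S a).Finite :=
    (Finset.Ico 1 d).finite_toSet.biUnion fun a _ => hSfin a
  have h1 := (Set.ncard_le_ncard hsub hfin).trans (Finset.set_ncard_biUnion_le _ _)
  have hq : 0 < Fintype.card F := Fintype.card_pos
  have hS : ∀ a ∈ Finset.Ico 1 d,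
      (S a).ncard * Fintype.card F ^ d ≤ Fintype.card F ^ (B d + 2) := by
    intro a ha
    rw [Finset.mem_Ico] at ha
    have h2 := Set.ncard_image_le (f := fun p : MvPolynomial (Fin 2) F × MvPolynomial (Fin 2) F =>
      p.1 * p.2) ((A_finite F a).prod (A_finite F (d - a)))
    rw [Set.ncard_prod, A_card, A_card] at h2
    have h3 := B_key a (d - a) ha.1 (by omega)
    rw [Nat.add_sub_cancel' ha.2.le] at h3
    calc (S a).ncard * Fintype.card F ^ d
        ≤ (Fintype.card F ^ B a * Fintype.card F ^ B (d - a)) * Fintype.card F ^ d := by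
          gcongr
      _ = Fintype.card F ^ (B a + B (d - a) + d) := by rw [pow_add, pow_add]
      _ ≤ _ := Nat.pow_le_pow_right hq h3
  calc _ ≤ (∑ a ∈ Finset.Ico 1 d, (S a).ncard) * Fintype.card F ^ d := by gcongr
    _ = ∑ a ∈ Finset.Ico 1 d, (S a).ncard * Fintype.card F ^ d := Finset.sum_mul _ _ _
    _ ≤ ∑ a ∈ Finset.Ico 1 d, Fintype.card F ^ (B d + 2) := Finset.sum_le_sum hS
    _ = (d - 1) * Fintype.card F ^ (B d + 2) := by simp
    _ ≤ _ := by gcongr; omega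

end AlmostAllIrr

/-- Almost all polynomials in two variables over a finite field are
irreducible: `I d / N d → 1` as `d → ∞`. -/
theorem almost_all_irreducible_two_vars (F : Type*) [Field F] [Fintype F]
    (q : ℕ) (hq : q = Fintype.card F)
    (N I : ℕ → ℕ)
    (hN : ∀ d, N d = Set.ncard {f : MvPolynomial (Fin 2) F | f.totalDegree = d})
    (hI : ∀ d, I d = Set.ncard
      {f : MvPolynomial (Fin 2) F | f.totalDegree = d ∧ Irreducible f}) :
    Filter.Tendsto (fun d : ℕ => (I d : ℝ) / (N d : ℝ)) Filter.atTop (nhds 1) := by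
  have hq2 : 2 ≤ q := by
    rw [hq]
    exact Fintype.one_lt_card
  have hqR : (2 : ℝ) ≤ q := by exact_mod_cast hq2
  have hlim : Filter.Tendsto (fun d : ℕ => 1 - 2 * (q : ℝ) ^ 2 * ((d : ℝ) * ((q : ℝ)⁻¹) ^ d))
      Filter.atTop (nhds 1) := by
    have h := tendsto_self_mul_const_pow_of_lt_one (r := (q : ℝ)⁻¹) (by positivity)
      (inv_lt_one_of_one_lt₀ (by linarith))
    simpa using (h.const_mul (2 * (q : ℝ) ^ 2)).const_sub 1
  have hfin : ∀ d, {f : MvPolynomial (Fin 2) F | f.totalDegree = d}.Finite := fun d =>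
    (AlmostAllIrr.A_finite F d).subset (fun f hf => le_of_eq hf)
  have hle : ∀ d, I d ≤ N d := by
    intro d
    rw [hI, hN]
    exact Set.ncard_le_ncard (fun f hf => hf.1) (hfin d)
  refine tendsto_of_tendsto_of_tendsto_of_le_of_le' hlim tendsto_const_nhds ?_ ?_
  · filter_upwards [Filter.eventually_ge_atTop 1] with d hd
    have h1 := AlmostAllIrr.N_lower F d hd
    have h2 := AlmostAllIrr.R_upper F d hd
    rw [← hq, ← hN] at h1
    rw [← hq] at h2
    set R := Set.ncard {f : MvPolynomial (Fin 2) F | f.totalDegree = d ∧ ¬ Irreducible f} with hR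
    have h3 : N d ≤ I d + R := by
      rw [hN, hI, hR]
      refine (Set.ncard_le_ncard ?_ (((hfin d).subset fun f hf => hf.1).union
        ((hfin d).subset fun f hf => hf.1))).trans (Set.ncard_union_le _ _)
      intro f hf
      by_cases h : Irreducible f
      · exact Or.inl ⟨hf, h⟩
      · exact Or.inr ⟨hf, h⟩
    have h4 : R * q ^ d ≤ d * q ^ 2 * (2 * N d) := by
      calc R * q ^ d ≤ d * q ^ (AlmostAllIrr.B d + 2) := h2
        _ = d * q ^ 2 * q ^ AlmostAllIrr.B d := by ring
        _ ≤ _ := by gcongr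
    have hNpos : 0 < N d := by
      have : 0 < q ^ AlmostAllIrr.B d := by positivity
      omega
    have hNR : (0 : ℝ) < N d := by exact_mod_cast hNpos
    have h3R : (N d : ℝ) ≤ I d + R := by exact_mod_cast h3
    have h4R : (R : ℝ) * (q : ℝ) ^ d ≤ d * (q : ℝ) ^ 2 * (2 * N d) := by exact_mod_cast h4
    have hqd : (0 : ℝ) < (q : ℝ) ^ d := by positivity
    have h5 : (R : ℝ) ≤ 2 * (q : ℝ) ^ 2 * ((d : ℝ) * ((q : ℝ)⁻¹) ^ d) * N d := by
      rw [← le_div_iff₀ hqd] at h4R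
      refine h4R.trans (le_of_eq ?_)
      rw [inv_pow]
      field_simp
    rw [le_div_iff₀ hNR]
    linarith
  · refine Filter.Eventually.of_forall fun d => ?_
    exact div_le_one_of_le₀ (by exact_mod_cast hle d) (by positivity)
end

section
/- Let q ≥ 2 be an integer and for d ≥ 1 set N(d) = ((q^{d+1} − 1)/(q − 1)) · q^{d(d+1)/2}. Then for all a ≥ 1 and b ≥ 1, N(a) · N(b) ≤ q³ · N(a + b − 1). -/
lemma aux_T (m n : ℕ) : (m + n + 1) * (m + n + 1 + 1) / 2 + 1 =
    (m + 1) * (m + 1 + 1) / 2 + (n + 1) * (n + 1 + 1) / 2 + m * n := by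
  have h (d : ℕ) : 2 * (d * (d + 1) / 2) = d * (d + 1) :=
    Nat.mul_div_cancel' (Nat.even_mul_succ_self d).two_dvd
  have h1 := h (m + n + 1)
  have h2 := h (m + 1)
  have h3 := h (n + 1)
  nlinarith

lemma aux_ineq (q x y : ℝ) (hq : 2 ≤ q) (hx : 1 ≤ x) (hy : 1 ≤ y) :
    (x * q ^ 2 - 1) * (y * q ^ 2 - 1) ≤ (q - 1) * q ^ 2 * (x * y * q ^ 2 - 1) := by
  have hxy : 1 ≤ x * y := by nlinarith
  have hq2 : 4 ≤ q ^ 2 := by nlinarith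
  have h1 : 0 ≤ (q - 2) * q ^ 4 * (x * y - 1) :=
    mul_nonneg (mul_nonneg (by linarith) (by positivity)) (by linarith)
  have h2 : 0 ≤ q ^ 2 * (x + y - 2) := mul_nonneg (by positivity) (by linarith)
  have h3 : 0 ≤ (q - 2) * (q ^ 2 * (q ^ 2 - 1)) :=
    mul_nonneg (by linarith) (mul_nonneg (by positivity) (by linarith))
  nlinarith

/-- For `q ≥ 2` and `N d = ((q^(d+1)-1)/(q-1)) * q^(d(d+1)/2)`,
for all `a, b ≥ 1`, `N a * N b ≤ q^3 * N (a+b-1)`. -/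
theorem N_mul_le_q3 (q : ℕ) (hq : 2 ≤ q) (N : ℕ → ℝ)
    (hN : ∀ d, N d = ((q : ℝ) ^ (d + 1) - 1) / ((q : ℝ) - 1) * (q : ℝ) ^ (d * (d + 1) / 2)) :
    ∀ a b : ℕ, 1 ≤ a → 1 ≤ b → N a * N b ≤ (q : ℝ) ^ 3 * N (a + b - 1) := by
  intro a b ha hb
  obtain ⟨m, rfl⟩ := Nat.exists_eq_add_of_le' ha
  obtain ⟨n, rfl⟩ := Nat.exists_eq_add_of_le' hb
  have e : m + 1 + (n + 1) - 1 = m + n + 1 := by omega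
  rw [e, hN, hN, hN]
  have hQ : (2 : ℝ) ≤ q := by exact_mod_cast hq
  have hT := congrArg (fun k => (q : ℝ) ^ k) (aux_T m n)
  simp only [pow_add _ _ (m * n), pow_succ _ ((m + n + 1) * (m + n + 1 + 1) / 2)] at hT
  rw [pow_add _ ((m + 1) * (m + 1 + 1) / 2)] at hT
  generalize (q : ℝ) = Q at *
  have hM : 1 ≤ Q ^ (m * n) := one_le_pow₀ (by linarith)
  have hx : 1 ≤ Q ^ m := one_le_pow₀ (by linarith)
  have hy : 1 ≤ Q ^ n := one_le_pow₀ (by linarith)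
  have hP : 0 < Q ^ ((m + 1) * (m + 1 + 1) / 2) := pow_pos (by linarith) _
  have hR : 0 < Q ^ ((n + 1) * (n + 1 + 1) / 2) := pow_pos (by linarith) _
  have key := aux_ineq Q _ _ hQ hx hy
  have e1 : Q ^ (m + 1 + 1) = Q ^ m * Q ^ 2 := by ring
  have e2 : Q ^ (n + 1 + 1) = Q ^ n * Q ^ 2 := by ring
  have e3 : Q ^ (m + n + 1 + 1) = Q ^ m * Q ^ n * Q ^ 2 := by ring
  rw [e1, e2, e3]
  generalize Q ^ ((m + 1) * (m + 1 + 1) / 2) = P at *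
  generalize Q ^ ((n + 1) * (n + 1 + 1) / 2) = R at *
  generalize Q ^ ((m + n + 1) * (m + n + 1 + 1) / 2) = S at *
  generalize Q ^ (m * n) = M at *
  generalize Q ^ m = x at *
  generalize Q ^ n = y at *
  have hD : 0 < Q - 1 := by linarith
  have hC : 0 ≤ x * y * Q ^ 2 - 1 := by
    have : 1 ≤ x * y := by nlinarith
    nlinarith
  have r : Q ^ 3 * ((x * y * Q ^ 2 - 1) / (Q - 1) * S)
      = ((Q - 1) * Q ^ 2 * (x * y * Q ^ 2 - 1)) / (Q - 1) ^ 2 * (P * R) * M := by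
    field_simp
    linear_combination (x * y * Q ^ 2 - 1) * hT
  have l : (x * Q ^ 2 - 1) / (Q - 1) * P * ((y * Q ^ 2 - 1) / (Q - 1) * R)
      = ((x * Q ^ 2 - 1) * (y * Q ^ 2 - 1)) / (Q - 1) ^ 2 * (P * R) := by
    field_simp
  rw [r, l]
  calc _ ≤ ((Q - 1) * Q ^ 2 * (x * y * Q ^ 2 - 1)) / (Q - 1) ^ 2 * (P * R) := by gcongr
    _ ≤ _ := le_mul_of_one_le_right (by positivity) hM
end

section
/- Let q ≥ 2 be an integer and for d ≥ 1 set N(d) = ((q^{d+1} − 1)/(q − 1)) · q^{d(d+1)/2}. Then for all a ≥ 3 and b ≥ 3, N(a) · N(b) ≤ q⁵ · N(a + b − 2). -/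
lemma key_ineq (q u v : ℝ) (hq : 2 ≤ q) (hu : 1 ≤ u) (hv : 1 ≤ v) :
    (q ^ 4 * u - 1) * (q ^ 4 * v - 1) ≤ q ^ 3 * (u * v) * ((q - 1) * (q ^ 5 * (u * v) - 1)) := by
  have hw : 1 ≤ u * v := one_le_mul_of_one_le_of_one_le hu hv
  have h3 : 1 ≤ q ^ 3 := one_le_pow₀ (by linarith)
  have h5 : 1 ≤ q ^ 5 := one_le_pow₀ (by linarith)
  have h5w : 1 ≤ q ^ 5 * (u * v) := one_le_mul_of_one_le_of_one_le h5 hw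
  have h1 : q ^ 3 * (u * v) * (1 * (q ^ 5 * (u * v) - 1))
      ≤ q ^ 3 * (u * v) * ((q - 1) * (q ^ 5 * (u * v) - 1)) := by
    apply mul_le_mul_of_nonneg_left _ (by positivity)
    exact mul_le_mul_of_nonneg_right (by linarith) (by linarith)
  refine le_trans ?_ h1
  have e1 : 0 ≤ q ^ 3 * (u * v - 1) * (q ^ 5 * (u * v) - 1) :=
    mul_nonneg (mul_nonneg (by linarith) (by linarith)) (by linarith)
  have e2 : 0 ≤ q ^ 4 * (u + v - 2) := mul_nonneg (by positivity) (by linarith)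
  have e3 : 0 ≤ q ^ 3 * (q - 2) := mul_nonneg (by positivity) (by linarith)
  nlinarith

/-- For `q ≥ 2` and `N d = ((q^(d+1)-1)/(q-1)) * q^(d(d+1)/2)`,
for all `a, b ≥ 3`, `N a * N b ≤ q^5 * N (a+b-2)`. -/
theorem N_mul_le_q5 (q : ℕ) (hq : 2 ≤ q) (N : ℕ → ℝ)
    (hN : ∀ d, N d = ((q : ℝ) ^ (d + 1) - 1) / ((q : ℝ) - 1) * (q : ℝ) ^ (d * (d + 1) / 2)) :
    ∀ a b : ℕ, 3 ≤ a → 3 ≤ b → N a * N b ≤ (q : ℝ) ^ 5 * N (a + b - 2) := by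
  intro a b ha hb
  obtain ⟨x, rfl⟩ := Nat.exists_eq_add_of_le ha
  obtain ⟨y, rfl⟩ := Nat.exists_eq_add_of_le hb
  have hs : 3 + x + (3 + y) - 2 = x + y + 4 := by omega
  rw [hs, hN, hN, hN]
  have hQ : (2 : ℝ) ≤ q := by exact_mod_cast hq
  generalize (q : ℝ) = Q at hQ
  have hT : 5 + (x + y + 4) * (x + y + 4 + 1) / 2
      = ((3 + x) * (3 + x + 1) / 2 + (3 + y) * (3 + y + 1) / 2) + (3 + x + y) + x * y := by
    have p1 := Nat.two_mul_div_two_of_even (Nat.even_mul_succ_self (x + y + 4))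
    have p2 := Nat.two_mul_div_two_of_even (Nat.even_mul_succ_self (3 + x))
    have p3 := Nat.two_mul_div_two_of_even (Nat.even_mul_succ_self (3 + y))
    nlinarith
  have hu : 1 ≤ Q ^ x := one_le_pow₀ (by linarith)
  have hv : 1 ≤ Q ^ y := one_le_pow₀ (by linarith)
  have hxy : 1 ≤ Q ^ (x * y) := one_le_pow₀ (by linarith)
  have key := key_ineq Q _ _ hQ hu hv
  generalize (x + y + 4) * (x + y + 4 + 1) / 2 = t at hT ⊢
  generalize (3 + x) * (3 + x + 1) / 2 = r at hT ⊢
  generalize (3 + y) * (3 + y + 1) / 2 = s at hT ⊢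
  have hc : 0 < Q - 1 := by linarith
  have hp : Q ^ 5 * Q ^ t = Q ^ r * Q ^ s * (Q ^ 3 * (Q ^ x * Q ^ y)) * Q ^ (x * y) := by
    rw [← pow_add, hT]; ring
  have hL : (Q ^ (3 + x + 1) - 1) / (Q - 1) * Q ^ r * ((Q ^ (3 + y + 1) - 1) / (Q - 1) * Q ^ s)
      = Q ^ r * Q ^ s / (Q - 1) ^ 2 * ((Q ^ 4 * Q ^ x - 1) * (Q ^ 4 * Q ^ y - 1)) := by
    field_simp
    ring
  have hR : Q ^ 5 * ((Q ^ (x + y + 4 + 1) - 1) / (Q - 1) * Q ^ t)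
      = Q ^ r * Q ^ s / (Q - 1) ^ 2 * (Q ^ 3 * (Q ^ x * Q ^ y) *
        ((Q - 1) * (Q ^ 5 * (Q ^ x * Q ^ y) - 1)) * Q ^ (x * y)) := by
    calc _ = (Q ^ 5 * Q ^ t) * ((Q ^ (x + y + 4 + 1) - 1) / (Q - 1)) := by ring
      _ = _ := by
        rw [hp, show Q ^ (x + y + 4 + 1) = Q ^ 5 * (Q ^ x * Q ^ y) by ring]
        field_simp
  rw [hL, hR]
  apply mul_le_mul_of_nonneg_left _ (by positivity)
  refine key.trans (le_mul_of_one_le_right ?_ hxy)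
  have h5 : 1 ≤ Q ^ 5 := one_le_pow₀ (by linarith)
  have h5w := one_le_mul_of_one_le_of_one_le h5 (one_le_mul_of_one_le_of_one_le hu hv)
  exact mul_nonneg (by positivity) (mul_nonneg hc.le (by linarith))
end

section
/- Let F be a finite field with q elements. For e ≥ 1 let N(e) be the number of polynomials in F[x,y] of total degree exactly e, and for d ≥ 2 let R(d) be the number of reducible polynomials in F[x,y] of total degree exactly d (nonzero polynomials of degree d that are not irreducible and not a unit). Then there exists d₀ ≥ 1 such that for all d ≥ d₀: (1 − 1/d) · N(1) · N(d−1) ≤ (q − 1) · R(d) ≤ (1 + 1/d) · N(1) · N(d−1). -/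
open MvPolynomial

def tri : ℕ → ℕ
  | 0 => 1
  | e + 1 => tri e + (e + 2)

lemma tri_pairs (e : ℕ) : ({p : ℕ × ℕ | p.1 + p.2 ≤ e}).ncard = tri e ∧
    ({p : ℕ × ℕ | p.1 + p.2 ≤ e}).Finite := by
  induction e with
  | zero =>
    have : {p : ℕ × ℕ | p.1 + p.2 ≤ 0} = {(0, 0)} := by
      ext ⟨a, b⟩; simp
    rw [this]; simp [tri]
  | succ e ih =>
    have : {p : ℕ × ℕ | p.1 + p.2 ≤ e + 1} =
        {p : ℕ × ℕ | p.1 + p.2 ≤ e} ∪ ((Finset.HasAntidiagonal.antidiagonal (e + 1) : Finset (ℕ × ℕ)) : Set (ℕ × ℕ)) := by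
      ext ⟨a, b⟩; simp; omega
    rw [this]
    refine ⟨?_, ih.2.union (Finset.finite_toSet _)⟩
    rw [Set.ncard_union_eq _ ih.2 (Finset.finite_toSet _), ih.1, Set.ncard_coe_finset,
      Finset.Nat.card_antidiagonal, tri]
    rw [Set.disjoint_left]
    rintro ⟨a, b⟩ h1 h2
    simp at h1 h2
    omega

lemma tri_exps (e : ℕ) : Nat.card {n : Fin 2 →₀ ℕ | (n.sum fun _ e => e) ≤ e} = tri e ∧
    ({n : Fin 2 →₀ ℕ | (n.sum fun _ e => e) ≤ e}).Finite := by
  have key : ∀ n : Fin 2 →₀ ℕ, (n.sum fun _ e => e) = n 0 + n 1 := by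
    intro n
    rw [Finsupp.sum_fintype _ _ (by simp)]; simp
  have E : {n : Fin 2 →₀ ℕ | (n.sum fun _ e => e) ≤ e} ≃ {p : ℕ × ℕ | p.1 + p.2 ≤ e} :=
    (Finsupp.equivFunOnFinite.trans (finTwoArrowEquiv ℕ)).subtypeEquiv (by
      intro n
      simp [key])
  refine ⟨?_, ?_⟩
  · rw [Nat.card_congr E, Nat.card_coe_set_eq, (tri_pairs e).1]
  · have := (tri_pairs e).2
    have h2 := this.to_subtype
    exact @Set.toFinite _ _ (Finite.of_equiv _ E.symm)

section
variable (F : Type*) [Field F] [Fintype F]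

lemma card_le_deg (e : ℕ) :
    ({f : MvPolynomial (Fin 2) F | f.totalDegree ≤ e}).ncard = Fintype.card F ^ tri e ∧
    ({f : MvPolynomial (Fin 2) F | f.totalDegree ≤ e}).Finite := by
  have h : {f : MvPolynomial (Fin 2) F | f.totalDegree ≤ e} =
      (restrictTotalDegree (Fin 2) F e : Set (MvPolynomial (Fin 2) F)) := by
    ext f
    simp only [Set.mem_ofPred_eq, SetLike.mem_coe, mem_restrictTotalDegree]
  rw [h]
  have hf : Finite (restrictTotalDegree (Fin 2) F e) := Module.finite_of_finite F
  refine ⟨?_, Set.toFinite _⟩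
  rw [← Nat.card_coe_set_eq]
  have h1 := Module.natCard_eq_pow_finrank (K := F) (V := restrictTotalDegree (Fin 2) F e)
  have h2 := Module.finrank_eq_nat_card_basis
    (basisRestrictSupport F {n : Fin 2 →₀ ℕ | (n.sum fun _ e => e) ≤ e})
  rw [(tri_exps e).1] at h2
  rw [← Nat.card_eq_fintype_card, ← h2]
  exact h1

lemma fin_deg (e : ℕ) : ({f : MvPolynomial (Fin 2) F | f.totalDegree = e}).Finite :=
  (card_le_deg F e).2.subset (fun _ h => le_of_eq h)

lemma N_le (e : ℕ) :
    ({f : MvPolynomial (Fin 2) F | f.totalDegree = e}).ncard ≤ Fintype.card F ^ tri e := by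
  rw [← (card_le_deg F e).1]
  exact Set.ncard_le_ncard (fun _ h => le_of_eq h) (card_le_deg F e).2

lemma le_N (e : ℕ) (he : 1 ≤ e) : Fintype.card F ^ tri e ≤
    2 * ({f : MvPolynomial (Fin 2) F | f.totalDegree = e}).ncard := by
  obtain ⟨e, rfl⟩ : ∃ k, e = k + 1 := ⟨e - 1, by omega⟩
  have h : {f : MvPolynomial (Fin 2) F | f.totalDegree ≤ e + 1} =
    {f : MvPolynomial (Fin 2) F | f.totalDegree = e + 1} ∪
    {f : MvPolynomial (Fin 2) F | f.totalDegree ≤ e} := by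
    ext f; simp; omega
  have h1 := Set.ncard_union_le {f : MvPolynomial (Fin 2) F | f.totalDegree = e + 1}
    {f : MvPolynomial (Fin 2) F | f.totalDegree ≤ e}
  rw [← h, (card_le_deg F _).1, (card_le_deg F _).1] at h1
  have h2 : 2 * Fintype.card F ^ tri e ≤ Fintype.card F ^ tri (e + 1) := by
    rw [tri, show tri e + (e + 2) = (tri e + (e + 1)) + 1 by ring, pow_succ, mul_comm]
    exact Nat.mul_le_mul (Nat.pow_le_pow_right Fintype.card_pos (by omega))
      Fintype.one_lt_card
  omega

variable {F}

lemma deg_mul {g h : MvPolynomial (Fin 2) F} (hgh : g * h ≠ 0) :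
    (g * h).totalDegree = g.totalDegree + h.totalDegree :=
  totalDegree_mul_of_isDomain (left_ne_zero_of_mul hgh) (right_ne_zero_of_mul hgh)

lemma ne_zero_of_deg {g : MvPolynomial (Fin 2) F} (h : 1 ≤ g.totalDegree) : g ≠ 0 := by
  rintro rfl; simp at h

lemma isUnit_of_deg {g : MvPolynomial (Fin 2) F} (h : g.totalDegree = 0) (h0 : g ≠ 0) :
    ∃ c : Fˣ, g = C (c : F) := by
  have h1 := totalDegree_eq_zero_iff_eq_C.mp h
  have : coeff 0 g ≠ 0 := by
    intro h2; rw [h2] at h1; simp at h1; exact h0 h1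
  exact ⟨Units.mk0 _ this, h1⟩

lemma isUnit_Cu (c : Fˣ) : IsUnit (C (c : F) : MvPolynomial (Fin 2) F) :=
  c.isUnit.map C

lemma deg_of_isUnit {g : MvPolynomial (Fin 2) F} (h : IsUnit g) : g.totalDegree = 0 := by
  obtain ⟨k, hk⟩ := h.exists_right_inv
  have := deg_mul (g := g) (h := k) (by rw [hk]; exact one_ne_zero)
  rw [hk] at this
  simp at this; omega

lemma isUnit_iff_deg {g : MvPolynomial (Fin 2) F} (h0 : g ≠ 0) :
    IsUnit g ↔ g.totalDegree = 0 := by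
  refine ⟨deg_of_isUnit, fun h => ?_⟩
  obtain ⟨c, rfl⟩ := isUnit_of_deg h h0
  exact isUnit_Cu c

lemma deg_Cu_mul (c : Fˣ) (g : MvPolynomial (Fin 2) F) :
    (C (c : F) * g).totalDegree = g.totalDegree := by
  by_cases h0 : g = 0
  · simp [h0]
  · rw [deg_mul (mul_ne_zero (isUnit_Cu c).ne_zero h0)]; simp

lemma prime_of_deg {g : MvPolynomial (Fin 2) F} (h : g.totalDegree = 1) : Prime g := by
  rw [← irreducible_iff_prime]
  have h0 := ne_zero_of_deg h.ge
  refine ⟨fun hu => by have := deg_of_isUnit hu; omega, ?_⟩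
  rintro a b rfl
  have := deg_mul h0
  rw [isUnit_iff_deg (left_ne_zero_of_mul h0), isUnit_iff_deg (right_ne_zero_of_mul h0)]
  omega

/-- factorization of a reducible polynomial -/
lemma exists_fact {f : MvPolynomial (Fin 2) F} {d : ℕ} (hd : 2 ≤ d) (hf : f.totalDegree = d)
    (hr : ¬ Irreducible f) : ∃ p : MvPolynomial (Fin 2) F × MvPolynomial (Fin 2) F,
      p.1 * p.2 = f ∧ 1 ≤ p.1.totalDegree ∧ 2 * p.1.totalDegree ≤ d ∧
      p.2.totalDegree = d - p.1.totalDegree := by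
  have h0 : f ≠ 0 := ne_zero_of_deg (by omega)
  rw [irreducible_iff] at hr
  push Not at hr
  obtain ⟨a, b, rfl, ha, hb⟩ := hr (by rw [isUnit_iff_deg h0]; omega)
  have h1 := deg_mul h0
  rw [isUnit_iff_deg (left_ne_zero_of_mul h0)] at ha
  rw [isUnit_iff_deg (right_ne_zero_of_mul h0)] at hb
  by_cases hab : a.totalDegree ≤ b.totalDegree
  · exact ⟨(a, b), rfl, by dsimp only; omega, by dsimp only; omega, by dsimp only; omega⟩
  · exact ⟨(b, a), mul_comm _ _, by dsimp only; omega, by dsimp only; omega, by dsimp only; omega⟩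

variable (F) in
abbrev Dg (e : ℕ) : Set (MvPolynomial (Fin 2) F) := {f | f.totalDegree = e}

variable (F) in
abbrev Rd (d : ℕ) : Set (MvPolynomial (Fin 2) F) := {f | f.totalDegree = d ∧ ¬ Irreducible f}

lemma fin_Rd (d : ℕ) : (Rd F d).Finite := (fin_deg F d).subset fun _ h => h.1

lemma card_units_set : (Set.univ : Set Fˣ).ncard = Fintype.card F - 1 := by
  classical
  rw [Set.ncard_univ, Nat.card_eq_fintype_card, Fintype.card_units]

lemma Cu_inv (c : Fˣ) : (C (c : F) : MvPolynomial (Fin 2) F) * C ((c⁻¹ : Fˣ) : F) = 1 := by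
  rw [← C_mul]; simp

lemma upper (d : ℕ) (hd : 2 ≤ d) : (Fintype.card F - 1) * (Rd F d).ncard ≤
    ∑ i ∈ Finset.Icc 1 (d / 2), (Dg F i).ncard * (Dg F (d - i)).ncard := by
  classical
  choose! φ h1 h2 h3 h4 using fun (f : MvPolynomial (Fin 2) F) (hf : f ∈ Rd F d) =>
    exists_fact hd hf.1 hf.2
  let T : Set (MvPolynomial (Fin 2) F × MvPolynomial (Fin 2) F) :=
    ⋃ i ∈ Finset.Icc 1 (d / 2), Dg F i ×ˢ Dg F (d - i)
  have hT : T.Finite := Set.Finite.biUnion (Finset.finite_toSet _)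
    (fun i _ => (fin_deg F i).prod (fin_deg F _))
  have hTc : T.ncard ≤ ∑ i ∈ Finset.Icc 1 (d / 2), (Dg F i).ncard * (Dg F (d - i)).ncard := by
    refine (Finset.set_ncard_biUnion_le _ _).trans (le_of_eq ?_)
    simp [Set.ncard_prod]
  refine le_trans ?_ hTc
  rw [← card_units_set (F := F), ← Set.ncard_prod]
  refine Set.ncard_le_ncard_of_injOn
    (fun x => (C (x.1 : F) * (φ x.2).1, C ((x.1⁻¹ : Fˣ) : F) * (φ x.2).2)) ?_ ?_ hT
  · rintro ⟨c, f⟩ ⟨-, hf⟩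
    have := h2 f hf
    have := h3 f hf
    have := h4 f hf
    simp only [T, Set.mem_iUnion]
    refine ⟨(φ f).1.totalDegree, by simp; omega, ?_⟩
    simp only [Set.mem_prod, Set.mem_ofPred_eq, deg_Cu_mul]
    exact ⟨trivial, h4 f hf⟩
  · rintro ⟨c, f⟩ ⟨-, hf⟩ ⟨c', f'⟩ ⟨-, hf'⟩ h
    simp only [Prod.mk.injEq] at h
    have hpr : ∀ (c : Fˣ) (f) (_ : f ∈ Rd F d),
        (C (c : F) * (φ f).1) * (C ((c⁻¹ : Fˣ) : F) * (φ f).2) = f := by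
      intro c f hf
      rw [mul_mul_mul_comm, Cu_inv, one_mul, h1 f hf]
    have e : f = f' := by
      rw [← hpr c f hf, ← hpr c' f' hf', h.1, h.2]
    subst e
    have h0 : (φ f).1 ≠ 0 := ne_zero_of_deg (h2 f hf)
    have := mul_right_cancel₀ h0 h.1
    have := C_injective _ _ this
    rw [Units.ext this]

lemma lower (d : ℕ) (hd : 2 ≤ d) : (Dg F 1).ncard * (Dg F (d - 1)).ncard ≤
    (Fintype.card F - 1) * (Rd F d).ncard +
      (Dg F 1).ncard * ((Dg F 1).ncard * (Dg F (d - 2)).ncard) := by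
  classical
  let A := Dg F 1 ×ˢ Dg F (d - 1)
  let B' := Dg F 1 ×ˢ (Dg F 1 ×ˢ Dg F (d - 2))
  have hA : A.Finite := (fin_deg F _).prod (fin_deg F _)
  have hB' : B'.Finite := (fin_deg F _).prod ((fin_deg F _).prod (fin_deg F _))
  let ψ : MvPolynomial (Fin 2) F × MvPolynomial (Fin 2) F × MvPolynomial (Fin 2) F →
    MvPolynomial (Fin 2) F × MvPolynomial (Fin 2) F := fun x => (x.1, x.2.1 * x.2.2)
  let B := ψ '' B'
  have hB : B.Finite := hB'.image _
  have hBc : B.ncard ≤ B'.ncard := Set.ncard_image_le hB'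
  have hBc' : B'.ncard = (Dg F 1).ncard * ((Dg F 1).ncard * (Dg F (d - 2)).ncard) := by
    simp only [B', Set.ncard_prod]
  have hAc : A.ncard = (Dg F 1).ncard * (Dg F (d - 1)).ncard := Set.ncard_prod
  have hAB : A.ncard ≤ (A \ B).ncard + B.ncard := Set.ncard_le_ncard_sdiff_add_ncard A B hB
  suffices (A \ B).ncard ≤ (Fintype.card F - 1) * (Rd F d).ncard by omega
  have hAB : (A \ B).Finite := hA.sdiff
  have hdeg : ∀ x ∈ A, x.1 * x.2 ≠ 0 := by
    rintro ⟨l, h⟩ ⟨h1, h2⟩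
    simp only [Set.mem_ofPred_eq] at h1 h2
    exact mul_ne_zero (ne_zero_of_deg h1.ge) (ne_zero_of_deg (by rw [h2]; omega))
  rw [Set.ncard_eq_toFinset_card _ hAB, Set.ncard_eq_toFinset_card _ (fin_Rd d)]
  apply Finset.card_le_mul_card_image_of_maps_to (f := fun x => x.1 * x.2)
  · rintro ⟨l, h⟩ hx
    rw [Set.Finite.mem_toFinset] at hx
    have h0 := hdeg _ hx.1
    have h3 := deg_mul h0
    obtain ⟨⟨h1, h2⟩, -⟩ := hx
    simp only [Set.mem_ofPred_eq] at h1 h2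
    simp only [Set.Finite.mem_toFinset, Set.mem_ofPred_eq]
    refine ⟨by rw [h3]; dsimp only; omega, fun hi => ?_⟩
    rcases hi.isUnit_or_isUnit rfl with hu | hu <;> have := deg_of_isUnit hu <;> omega
  · intro f _
    rcases Finset.eq_empty_or_nonempty {x ∈ hAB.toFinset | x.1 * x.2 = f} with he | ⟨⟨l, h⟩, hx⟩
    · rw [he]; simp
    · rw [← Fintype.card_units, ← Finset.card_univ]
      refine le_trans (Finset.card_le_card (t := Finset.univ.image
        (fun c : Fˣ => (C (c : F) * l, C ((c⁻¹ : Fˣ) : F) * h))) ?_) Finset.card_image_le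
      rintro ⟨l', h'⟩ hx'
      rw [Finset.mem_filter, Set.Finite.mem_toFinset] at hx hx'
      obtain ⟨⟨⟨hl, hh⟩, hnB⟩, hm⟩ := hx
      obtain ⟨⟨⟨hl', hh'⟩, -⟩, hm'⟩ := hx'
      simp only [Set.mem_ofPred_eq] at hl hh hl' hh' hm hm'
      have hl0 : l ≠ 0 := ne_zero_of_deg hl.ge
      have hl0' : l' ≠ 0 := ne_zero_of_deg hl'.ge
      have hdl : l' ∣ l := by
        have hdvd : l' ∣ l * h := by rw [hm, ← hm']; exact dvd_mul_right _ _
        rcases (prime_of_deg hl').dvd_or_dvd hdvd with hd1 | ⟨k, rfl⟩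
        · exact hd1
        · exfalso
          apply hnB
          have := deg_mul (ne_zero_of_deg (F := F) (g := l' * k) (by omega))
          exact ⟨(l, l', k), ⟨hl, hl', by simp only [Set.mem_ofPred_eq]; omega⟩, rfl⟩
      obtain ⟨k, rfl⟩ := hdl
      have hk := deg_mul hl0
      obtain ⟨c, rfl⟩ := isUnit_of_deg (g := k) (by omega) (right_ne_zero_of_mul hl0)
      rw [Finset.mem_image]
      refine ⟨c⁻¹, Finset.mem_univ _, ?_⟩
      have hci := Cu_inv c
      simp only [inv_inv, Prod.mk.injEq]
      refine ⟨by linear_combination l' * hci, ?_⟩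
      apply mul_left_cancel₀ hl0'
      linear_combination hm - hm'

end

lemma tri_closed (e : ℕ) : 2 * tri e = (e + 1) * (e + 2) := by
  induction e with
  | zero => rfl
  | succ e ih => rw [tri, mul_add, ih]; ring

lemma tri_bound (d i : ℕ) (h1 : 2 ≤ i) (h2 : i ≤ d / 2) : tri i + tri (d - i) ≤ 6 + tri (d - 2) := by
  obtain ⟨a, rfl⟩ : ∃ a, i = a + 2 := ⟨i - 2, by omega⟩
  obtain ⟨b, rfl⟩ : ∃ b, d = (a + 2) + (b + 2) := ⟨d - (a + 2) - 2, by omega⟩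
  have e1 := tri_closed (a + 2)
  have e2 := tri_closed (b + 2)
  have e3 := tri_closed (a + b + 2)
  rw [show a + 2 + (b + 2) - (a + 2) = b + 2 by omega,
    show a + 2 + (b + 2) - 2 = a + b + 2 by omega]
  nlinarith [Nat.zero_le (a * b)]

lemma pow_bound (d : ℕ) (hd : 20 ≤ d) : 4 * d ^ 2 ≤ 2 ^ (d - 3) := by
  induction d, hd using Nat.le_induction with
  | base => norm_num
  | succ d hd ih =>
    rw [show d + 1 - 3 = (d - 3) + 1 by omega, pow_succ 2]
    nlinarith

/-- With `N e` the number of polynomials in `F[x,y]` of total degree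
exactly `e` and `R d` (for `d ≥ 2`) the number of reducible polynomials of total
degree exactly `d`, there is `d₀ ≥ 1` such that for all `d ≥ d₀`:
`(1 - 1/d) * N 1 * N (d-1) ≤ (q-1) * R d ≤ (1 + 1/d) * N 1 * N (d-1)`. -/
theorem reducible_count_estimate (F : Type*) [Field F] [Fintype F]
    (q : ℕ) (hq : q = Fintype.card F)
    (N R : ℕ → ℕ)
    (hN : ∀ e, N e = Set.ncard {f : MvPolynomial (Fin 2) F | f.totalDegree = e})
    (hR : ∀ d, 2 ≤ d → R d = Set.ncard
      {f : MvPolynomial (Fin 2) F | f.totalDegree = d ∧ ¬ Irreducible f}) :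
    ∃ d₀ : ℕ, 1 ≤ d₀ ∧ ∀ d : ℕ, d₀ ≤ d →
      (1 - 1 / (d : ℝ)) * (N 1 : ℝ) * (N (d - 1) : ℝ) ≤ ((q : ℝ) - 1) * (R d : ℝ) ∧
      ((q : ℝ) - 1) * (R d : ℝ) ≤ (1 + 1 / (d : ℝ)) * (N 1 : ℝ) * (N (d - 1) : ℝ) := by
  refine ⟨20, by norm_num, fun d hd => ?_⟩
  have hq2 : 2 ≤ q := by rw [hq]; exact Fintype.one_lt_card
  have hup := upper (F := F) d (by omega)
  have hlo := lower (F := F) d (by omega)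
  have hNle : ∀ e, N e ≤ q ^ tri e := fun e => by rw [hN, hq]; exact N_le F e
  have hleN : ∀ e, 1 ≤ e → q ^ tri e ≤ 2 * N e := fun e he => by rw [hN, hq]; exact le_N F e he
  simp only [Dg, Rd, ← hN, ← hq, ← hR d (by omega)] at hup hlo
  set E := q ^ (6 + tri (d - 2)) with hE
  -- main term versus error term
  have hmain : d ^ 2 * E ≤ N 1 * N (d - 1) := by
    have h1 := hleN 1 le_rfl
    have h2 := hleN (d - 1) (by omega)
    have h3 : q ^ tri 1 * q ^ tri (d - 1) = q ^ (d - 3) * E := by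
      rw [hE, ← pow_add, ← pow_add]
      congr 1
      rw [show tri 1 = 3 from rfl, show d - 1 = (d - 2) + 1 by omega, tri]
      omega
    have h4 : 4 * d ^ 2 ≤ q ^ (d - 3) := (pow_bound d hd).trans (Nat.pow_le_pow_left hq2 _)
    have h5 := Nat.mul_le_mul h1 h2
    have h6 := Nat.mul_le_mul_right E h4
    rw [h3] at h5
    nlinarith
  have hup' : (q - 1) * R d ≤ N 1 * N (d - 1) + d * E := by
    refine hup.trans ?_
    rw [← Finset.add_sum_Ioc_eq_sum_Icc (by omega)]
    refine Nat.add_le_add_left ?_ _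
    refine (Finset.sum_le_card_nsmul _ _ E ?_).trans ?_
    · intro i hi
      rw [Finset.mem_Ioc] at hi
      refine (Nat.mul_le_mul (hNle i) (hNle (d - i))).trans ?_
      rw [← pow_add]
      exact Nat.pow_le_pow_right (by omega) (tri_bound d i (by omega) hi.2)
    · rw [smul_eq_mul, Nat.card_Ioc]
      exact Nat.mul_le_mul_right _ (by omega)
  have hlo' : N 1 * N (d - 1) ≤ (q - 1) * R d + E := by
    refine hlo.trans (Nat.add_le_add_left ?_ _)
    refine (Nat.mul_le_mul (hNle 1) (Nat.mul_le_mul (hNle 1) (hNle _))).trans (le_of_eq ?_)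
    rw [← pow_add, ← pow_add, hE, show tri 1 = 3 from rfl]
    congr 1
    omega
  have hdpos : (0 : ℝ) < d := by exact_mod_cast (by omega : 0 < d)
  have hd1 : (1 : ℝ) ≤ d := by exact_mod_cast (by omega : 1 ≤ d)
  have hq1 : ((q - 1 : ℕ) : ℝ) = (q : ℝ) - 1 := by
    rw [Nat.cast_sub (by omega)]; simp
  have a1 : ((d : ℝ)) ^ 2 * E ≤ N 1 * N (d - 1) := by exact_mod_cast hmain
  have a2 : ((q : ℝ) - 1) * R d ≤ N 1 * N (d - 1) + d * E := by
    rw [← hq1]; exact_mod_cast hup'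
  have a3 : (N 1 : ℝ) * N (d - 1) ≤ ((q : ℝ) - 1) * R d + E := by
    rw [← hq1]; exact_mod_cast hlo'
  have a4 : (d : ℝ) * E ≤ 1 / d * (N 1 * N (d - 1)) := by
    rw [one_div, ← div_eq_inv_mul, le_div_iff₀ hdpos]
    linarith
  have a5 : (E : ℝ) ≤ d * E := le_mul_of_one_le_left (Nat.cast_nonneg _) hd1
  constructor <;> nlinarith
end

section
/- Let F be a finite field with q elements and let m ≥ 2. Let N_m(d) be the number of polynomials in F[x₁, …, x_m] of total degree exactly d, and I_m(d) the number of irreducible polynomials in F[x₁, …, x_m] of total degree exactly d. Then, as d → ∞, the sequence 1 − I_m(d)/N_m(d) is asymptotically equivalent to ((q^{m+1} − q)/(q − 1)) · 1/q^{C(m+d−1, m−1)}. -/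
namespace IrrProp

open MvPolynomial

variable {F : Type*} [Field F] [Fintype F] {m : ℕ}

/-- polynomials of degree exactly d -/
def Dg (F : Type*) [Field F] (m d : ℕ) : Set (MvPolynomial (Fin m) F) :=
  {f | f.totalDegree = d}

/-- polynomials of degree at most d -/
def Le (F : Type*) [Field F] (m d : ℕ) : Set (MvPolynomial (Fin m) F) :=
  {f | f.totalDegree ≤ d}

/-- number of monomials -/
def b (m d : ℕ) : ℕ := (d + m).choose m

lemma ncard_monomials (m d : ℕ) :
    Nat.card {n : Fin m →₀ ℕ | (n.sum fun _ e => e) ≤ d} = b m d := by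
  classical
  have h : {n : Fin m →₀ ℕ | (n.sum fun _ e => e) ≤ d} =
      (((Finset.range (d+1)).biUnion fun k => (Finset.univ : Finset (Fin m)).finsuppAntidiag k :
        Finset (Fin m →₀ ℕ)) : Set (Fin m →₀ ℕ)) := by
    ext n
    simp [Finset.mem_finsuppAntidiag', -Finset.mem_finsuppAntidiag]
  rw [h, Nat.card_coe_set_eq, Set.ncard_coe_finset, Finset.card_biUnion]
  · simp only [Finset.card_finsuppAntidiag_nat_eq_multichoose]
    simp [Nat.sum_range_multichoose, b]
  · intro i _ j _ hij
    rw [Function.onFun, Finset.disjoint_left]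
    intro n h1 h2
    rw [Finset.mem_finsuppAntidiag] at h1 h2
    exact hij (h1.1.symm.trans h2.1)

lemma Le_eq (d : ℕ) : Le F m d = (restrictTotalDegree (Fin m) F d : Set _) := by
  ext f
  simp [Le, mem_restrictTotalDegree]

lemma Le_finite (d : ℕ) : (Le F m d).Finite := by
  rw [Le_eq]
  have : Finite (restrictTotalDegree (Fin m) F d) := Module.finite_of_finite F
  exact Set.toFinite _

lemma Le_ncard (d : ℕ) : (Le F m d).ncard = Fintype.card F ^ b m d := by
  rw [Le_eq, ← Nat.card_coe_set_eq]
  have := Module.natCard_eq_pow_finrank (K := F) (V := restrictTotalDegree (Fin m) F d)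
  rw [SetLike.coe_sort_coe, this, Nat.card_eq_fintype_card]
  congr 1
  unfold restrictTotalDegree
  rw [Module.finrank_eq_nat_card_basis (basisRestrictSupport F _)]
  exact ncard_monomials m d

lemma Dg_finite (d : ℕ) : (Dg F m d).Finite :=
  (Le_finite d).subset (fun f hf => le_of_eq hf)

lemma Dg_ncard_succ (d : ℕ) :
    (Dg F m (d+1)).ncard + Fintype.card F ^ b m d = Fintype.card F ^ b m (d+1) := by
  rw [← Le_ncard, ← Le_ncard, ← Set.ncard_union_eq _ (Dg_finite _) (Le_finite _)]
  · congr 1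
    ext f
    simp only [Dg, Le, Set.mem_union, Set.mem_ofPred_eq]
    omega
  · rw [Set.disjoint_left]
    intro f h1 h2
    simp only [Dg, Le, Set.mem_ofPred_eq] at h1 h2
    omega

lemma Dg_ncard_le (d : ℕ) : (Dg F m d).ncard ≤ Fintype.card F ^ b m d := by
  rw [← Le_ncard]
  exact Set.ncard_le_ncard (fun f hf => le_of_eq hf) (Le_finite d)

/-- leading coefficient -/
noncomputable def lc (f : MvPolynomial (Fin m) F) : F :=
  (MonomialOrder.degLex (σ := Fin m)).leadingCoeff f

lemma lc_mul (f g : MvPolynomial (Fin m) F) : lc (f * g) = lc f * lc g := by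
  simp [lc]

lemma lc_C (c : F) : lc (C c : MvPolynomial (Fin m) F) = c := by
  simp [lc]

lemma lc_ne {f : MvPolynomial (Fin m) F} (hf : f ≠ 0) : lc f ≠ 0 := by
  simpa [lc] using hf

lemma deg_mul {f g : MvPolynomial (Fin m) F} (hf : f ≠ 0) (hg : g ≠ 0) :
    (f * g).totalDegree = f.totalDegree + g.totalDegree :=
  totalDegree_mul_of_isDomain hf hg

lemma deg_C_mul {c : F} {f : MvPolynomial (Fin m) F} (hc : c ≠ 0) :
    (C c * f).totalDegree = f.totalDegree := by
  by_cases hf : f = 0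
  · simp [hf]
  · rw [deg_mul (by simpa using hc) hf, totalDegree_C, zero_add]

lemma isUnit_iff_deg {f : MvPolynomial (Fin m) F} (hf : f ≠ 0) :
    IsUnit f ↔ f.totalDegree = 0 := by
  rw [isUnit_iff_totalDegree_of_isReduced]
  refine ⟨fun h => h.2, fun h => ⟨?_, h⟩⟩
  rw [totalDegree_eq_zero_iff_eq_C] at h
  rw [isUnit_iff_ne_zero]
  intro h0
  rw [h0] at h
  exact hf (by simpa using h)

/-- normalised linear polynomials -/
def T (F : Type*) [Field F] (m : ℕ) : Set (MvPolynomial (Fin m) F) :=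
  {f | f.totalDegree = 1 ∧ lc f = 1}

lemma T_finite : (T F m).Finite := (Dg_finite 1).subset fun _ hf => hf.1

lemma ne_zero_of_deg {f : MvPolynomial (Fin m) F} {d : ℕ} (hd : d ≠ 0)
    (h : f.totalDegree = d) : f ≠ 0 := by
  rintro rfl
  simp at h
  omega

lemma T_ncard : (Fintype.card F - 1) * (T F m).ncard = (Dg F m 1).ncard := by
  have h1 : ({c : F | c ≠ 0}).ncard = Fintype.card F - 1 := by
    have : ({c : F | c ≠ 0}) = ({0} : Set F)ᶜ := by ext; simp
    rw [this, Set.ncard_compl, Set.ncard_singleton, Nat.card_eq_fintype_card]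
  rw [← h1, ← Set.ncard_prod]
  refine Set.ncard_congr (fun p _ => C p.1 * p.2) ?_ ?_ ?_
  · rintro ⟨c, f⟩ ⟨hc, hf⟩
    exact (deg_C_mul hc).trans hf.1
  · rintro ⟨c, f⟩ ⟨c', f'⟩ ⟨hc, hf⟩ ⟨hc', hf'⟩ h
    simp only at h hc hc' hf hf'
    have h2 := congrArg lc h
    rw [lc_mul, lc_mul, lc_C, lc_C, hf.2, hf'.2, mul_one, mul_one] at h2
    subst h2
    have : (C c : MvPolynomial (Fin m) F) ≠ 0 := by simpa using hc
    rw [mul_left_cancel₀ this h]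
  · intro f hf
    have hf0 : f ≠ 0 := ne_zero_of_deg one_ne_zero hf
    have hl := lc_ne hf0
    refine ⟨(lc f, C (lc f)⁻¹ * f), ⟨hl, ?_, ?_⟩, ?_⟩
    · exact (deg_C_mul (inv_ne_zero hl)).trans hf
    · simp [lc_mul, lc_C, hl]
    · simp only [← mul_assoc, ← C_mul]
      simp [hl]

/-- irreducibles -/
def Ir (F : Type*) [Field F] (m d : ℕ) : Set (MvPolynomial (Fin m) F) :=
  {f | f.totalDegree = d ∧ Irreducible f}

/-- reducibles -/
def Rd (F : Type*) [Field F] (m d : ℕ) : Set (MvPolynomial (Fin m) F) :=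
  {f | f.totalDegree = d ∧ ¬ Irreducible f}

lemma Ir_finite (d : ℕ) : (Ir F m d).Finite := (Dg_finite d).subset fun _ hf => hf.1
lemma Rd_finite (d : ℕ) : (Rd F m d).Finite := (Dg_finite d).subset fun _ hf => hf.1

lemma Ir_add_Rd (d : ℕ) : (Ir F m d).ncard + (Rd F m d).ncard = (Dg F m d).ncard := by
  rw [← Set.ncard_union_eq _ (Ir_finite _) (Rd_finite _)]
  · congr 1
    ext f
    simp only [Dg, Ir, Rd, Set.mem_union, Set.mem_ofPred_eq]
    tauto
  · rw [Set.disjoint_left]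
    intro f h1 h2
    exact h2.2 h1.2

lemma lower {d : ℕ} (hd : 2 ≤ d) :
    (T F m).ncard * (Ir F m d).ncard ≤ (Rd F m (d+1)).ncard := by
  rw [← Set.ncard_prod]
  refine Set.ncard_le_ncard_of_injOn (fun p => p.1 * p.2) ?_ ?_ (Rd_finite _)
  · rintro ⟨l, h⟩ ⟨hl, hh⟩
    simp only at hl hh
    have hl0 : l ≠ 0 := ne_zero_of_deg one_ne_zero hl.1
    have hh0 : h ≠ 0 := hh.2.ne_zero
    refine ⟨?_, ?_⟩
    · simp only [deg_mul hl0 hh0, hl.1, hh.1]; omega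
    · intro hi
      have := hi.isUnit_or_isUnit rfl
      rw [isUnit_iff_deg hl0, isUnit_iff_deg hh0, hl.1, hh.1] at this
      omega
  · rintro ⟨l, h⟩ ⟨hl, hh⟩ ⟨l', h'⟩ ⟨hl', hh'⟩ he
    simp only at hl hh hl' hh' he
    have hl0 : l ≠ 0 := ne_zero_of_deg one_ne_zero hl.1
    have hl0' : l' ≠ 0 := ne_zero_of_deg one_ne_zero hl'.1
    have hh0 : h ≠ 0 := hh.2.ne_zero
    have hh0' : h' ≠ 0 := hh'.2.ne_zero
    have hp : Prime h := hh.2.prime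
    have hdv : h ∣ l' * h' := ⟨l, by rw [← he, mul_comm]⟩
    rcases hp.dvd_or_dvd hdv with h1 | h1
    · have := totalDegree_le_of_dvd_of_isDomain h1 hl0'
      rw [hh.1, hl'.1] at this
      omega
    · obtain ⟨c, rfl⟩ := h1
      have hc0 : c ≠ 0 := by rintro rfl; simp at hh0'
      have hcd : c.totalDegree = 0 := by
        have := hh'.1
        rw [deg_mul hh0 hc0, hh.1] at this
        omega
      have hll : l = l' * c := by
        apply mul_right_cancel₀ hh0
        rw [he]; ring
      rw [totalDegree_eq_zero_iff_eq_C] at hcd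
      have h3 := congrArg lc hll
      rw [lc_mul, hl.2, hl'.2, one_mul, hcd, lc_C] at h3
      rw [← h3] at hcd
      have : c = 1 := by simpa using hcd
      subst this
      simp [hll]

lemma upper {d : ℕ} (hd : 2 ≤ d) :
    (Rd F m d).ncard ≤ (T F m).ncard * (Dg F m (d-1)).ncard +
      ∑ k ∈ Finset.Icc 2 (d-2), (Dg F m k).ncard * (Dg F m (d-k)).ncard := by
  have hsub : Rd F m d ⊆ (fun p : MvPolynomial (Fin m) F × MvPolynomial (Fin m) F => p.1 * p.2) ''
      (T F m ×ˢ Dg F m (d-1)) ∪ ⋃ k ∈ Finset.Icc 2 (d-2),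
      (fun p : MvPolynomial (Fin m) F × MvPolynomial (Fin m) F => p.1 * p.2) ''
      (Dg F m k ×ˢ Dg F m (d-k)) := by
    rintro f ⟨hf, hr⟩
    have hf0 : f ≠ 0 := ne_zero_of_deg (by omega) hf
    have hfu : ¬ IsUnit f := by rw [isUnit_iff_deg hf0]; omega
    rw [irreducible_iff] at hr
    push Not at hr
    obtain ⟨g, h, rfl, hg, hh⟩ := hr hfu
    have hg0 : g ≠ 0 := left_ne_zero_of_mul hf0
    have hh0 : h ≠ 0 := right_ne_zero_of_mul hf0
    rw [isUnit_iff_deg hg0] at hg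
    rw [isUnit_iff_deg hh0] at hh
    rw [deg_mul hg0 hh0] at hf
    have key : ∀ g h : MvPolynomial (Fin m) F, g ≠ 0 → g.totalDegree = 1 →
        h.totalDegree = d - 1 → g * h ∈ (fun p : MvPolynomial (Fin m) F × MvPolynomial (Fin m) F =>
          p.1 * p.2) '' (T F m ×ˢ Dg F m (d-1)) := by
      intro g h hg0 hg hh
      have hl := lc_ne hg0
      refine ⟨(C (lc g)⁻¹ * g, C (lc g) * h), ⟨⟨?_, ?_⟩, ?_⟩, ?_⟩
      · exact (deg_C_mul (inv_ne_zero hl)).trans hg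
      · simp [lc_mul, lc_C, hl]
      · exact (deg_C_mul hl).trans hh
      · have : (C (lc g)⁻¹ * C (lc g) : MvPolynomial (Fin m) F) = 1 := by
          rw [← C_mul]; simp [hl]
        calc C (lc g)⁻¹ * g * (C (lc g) * h) = (C (lc g)⁻¹ * C (lc g)) * (g * h) := by ring
          _ = g * h := by rw [this, one_mul]
    by_cases h1 : g.totalDegree = 1
    · left; exact key g h hg0 h1 (by omega)
    by_cases h2 : h.totalDegree = 1
    · left; rw [mul_comm]; exact key h g hh0 h2 (by omega)
    right
    simp only [Set.mem_iUnion]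
    refine ⟨g.totalDegree, by rw [Finset.mem_Icc]; omega, (g, h), ⟨rfl, ?_⟩, rfl⟩
    change h.totalDegree = _
    omega
  have fin1 : (T F m ×ˢ Dg F m (d-1)).Finite := T_finite.prod (Dg_finite _)
  have fin2 : ∀ k, (Dg F m k ×ˢ Dg F m (d-k)).Finite := fun k => (Dg_finite _).prod (Dg_finite _)
  refine (Set.ncard_le_ncard hsub ?_).trans ((Set.ncard_union_le _ _).trans ?_)
  · exact (fin1.image _).union (Set.Finite.biUnion (Finset.finite_toSet _)
      fun k _ => (fin2 k).image _)
  · refine add_le_add ?_ ?_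
    · rw [← Set.ncard_prod]; exact Set.ncard_image_le fin1
    · refine (Finset.set_ncard_biUnion_le _ _).trans (Finset.sum_le_sum fun k _ => ?_)
      rw [← Set.ncard_prod]; exact Set.ncard_image_le (fin2 k)

lemma b_succ {m : ℕ} (hm : 1 ≤ m) (j : ℕ) : b m (j+1) = b m j + (j + m).choose (m - 1) := by
  obtain ⟨n, rfl⟩ : ∃ n, m = n + 1 := ⟨m - 1, by omega⟩
  unfold b
  rw [show j + 1 + (n+1) = (j + (n+1)) + 1 by ring, Nat.choose_succ_succ]
  simp [add_comm]

lemma delta_ge {m : ℕ} (hm : 2 ≤ m) (j : ℕ) : j + 2 ≤ (j + m).choose (m - 1) := by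
  have h1 : (j + m).choose (m - 1) = (j + m).choose (j + 1) :=
    Nat.choose_symm_of_eq_add (by omega)
  have h2 : (j + 2).choose (j + 1) ≤ (j + m).choose (j + 1) := Nat.choose_le_choose _ (by omega)
  rw [Nat.choose_succ_self_right (j+1)] at h2
  omega

lemma b_conv {m : ℕ} (hm : 1 ≤ m) : ∀ i j : ℕ, i + 2 ≤ j →
    b m (i+2) + b m j ≤ b m 2 + b m (j + i)
  | 0, j, _ => by simp
  | i+1, j, h => by
    have ih := b_conv hm i (j+1) (by omega)
    have h1 := b_succ hm (i+2)
    have h2 := b_succ hm j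
    have h3 : (i + 2 + m).choose (m-1) ≤ (j + m).choose (m-1) :=
      Nat.choose_le_choose _ (by omega)
    rw [show j + (i + 1) = j + 1 + i by ring, show i + 1 + 2 = i + 2 + 1 by ring]
    omega

lemma b_conv' {m : ℕ} (hm : 1 ≤ m) {e k : ℕ} (h2 : 2 ≤ k) (hk : k ≤ e) :
    b m k + b m (e + 2 - k) ≤ b m 2 + b m e := by
  rcases le_total k (e + 2 - k) with h | h
  · have := b_conv hm (k - 2) (e + 2 - k) (by omega)
    rwa [show k - 2 + 2 = k by omega, show e + 2 - k + (k - 2) = e by omega] at this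
  · have := b_conv hm (e - k) k (by omega)
    rw [show e - k + 2 = e + 2 - k by omega, show k + (e - k) = e by omega] at this
    omega

lemma upper' (hm : 1 ≤ m) (e : ℕ) :
    (Rd F m (e+2)).ncard ≤ (T F m).ncard * Fintype.card F ^ b m (e+1) +
      e * (Fintype.card F ^ b m 2 * Fintype.card F ^ b m e) := by
  refine (upper (by omega)).trans (add_le_add (Nat.mul_le_mul_left _ (Dg_ncard_le _)) ?_)
  have : ∀ k ∈ Finset.Icc 2 (e + 2 - 2), (Dg F m k).ncard * (Dg F m (e+2-k)).ncard ≤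
      Fintype.card F ^ b m 2 * Fintype.card F ^ b m e := by
    intro k hk
    rw [Finset.mem_Icc] at hk
    refine (Nat.mul_le_mul (Dg_ncard_le _) (Dg_ncard_le _)).trans ?_
    rw [← pow_add, ← pow_add]
    exact Nat.pow_le_pow_right Fintype.card_pos (b_conv' hm hk.1 (by omega))
  refine (Finset.sum_le_card_nsmul _ _ _ this).trans ?_
  rw [smul_eq_mul, Nat.card_Icc]
  exact Nat.mul_le_mul_right _ (by omega)

open Filter Topology in
lemma analytic (v R N I r : ℕ → ℝ) (L B : ℝ) (hL : 0 < L) (hv : ∀ d, 0 < v d)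
    (hr : ∀ e, r e = v e / v (e+1)) (hrb : ∀ e, r e ≤ (1/2)^(e+2))
    (hN : ∀ d, N (d+1) = v (d+1) - v d) (hI : ∀ d, I d = N d - R d)
    (hu : ∀ e, R (e+2) ≤ L * v (e+1) + e * (B * v e))
    (hl : ∀ d, 2 ≤ d → L * I d ≤ R (d+1)) :
    Tendsto (fun d => (1 - I (d+3) / N (d+3)) / (L * r (d+2))) atTop (𝓝 1) := by
  have hrpos : ∀ e, 0 < r e := fun e => by rw [hr]; exact div_pos (hv _) (hv _)
  have hr0 : Tendsto r atTop (𝓝 0) := by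
    refine squeeze_zero (fun e => (hrpos e).le) hrb ?_
    exact (tendsto_add_atTop_iff_nat 2).2
      (tendsto_pow_atTop_nhds_zero_of_lt_one (by norm_num) (by norm_num))
  have her : Tendsto (fun e : ℕ => (e : ℝ) * r e) atTop (𝓝 0) := by
    refine squeeze_zero (fun e => mul_nonneg e.cast_nonneg (hrpos e).le)
      (g := fun e : ℕ => (e : ℝ) * (1/2)^e) (fun e => ?_)
      (tendsto_self_mul_const_pow_of_lt_one (by norm_num) (by norm_num))
    refine mul_le_mul_of_nonneg_left ((hrb e).trans ?_) e.cast_nonneg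
    exact pow_le_pow_of_le_one (by norm_num) (by norm_num) (by omega)
  have hU : ∀ e, R (e+2) / v (e+1) ≤ L + B * (e * r e) := by
    intro e
    have := hv (e+1)
    rw [div_le_iff₀ this, hr]
    refine (hu e).trans (le_of_eq ?_)
    field_simp
  have hU0 : Tendsto (fun e : ℕ => L + B * (e * r e)) atTop (𝓝 L) := by
    simpa using (her.const_mul B).const_add L
  have hLo : ∀ e, L * (1 - r (e+1) * (1 + (L + B * (e * r e)))) ≤ R (e+3) / v (e+2) := by
    intro e
    have h2 := hv (e+2)
    have h1 := hv (e+1)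
    have := hl (e+2) (by omega)
    rw [hI, hN (e+1)] at this
    have h3 := hU e
    rw [le_div_iff₀ h2]
    refine le_trans ?_ this
    rw [mul_assoc]
    refine mul_le_mul_of_nonneg_left ?_ hL.le
    rw [div_le_iff₀ h1] at h3
    have h4 : r (e+1) * v (e+2) = v (e+1) := by
      rw [hr]; field_simp
    calc (1 - r (e+1) * (1 + (L + B * (e * r e)))) * v (e+2)
        = v (e+2) - (r (e+1) * v (e+2)) * (1 + (L + B * (e * r e))) := by ring
      _ = v (e+2) - v (e+1) - (L + B * (e * r e)) * v (e+1) := by rw [h4]; ring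
      _ ≤ _ := by
        show _ ≤ v (e+2) - v (e+1) - R (e+2)
        linarith
  have hLo0 : Tendsto (fun e : ℕ => L * (1 - r (e+1) * (1 + (L + B * (e * r e))))) atTop (𝓝 L) := by
    have h1 : Tendsto (fun e => r (e+1)) atTop (𝓝 0) := (tendsto_add_atTop_iff_nat 1).2 hr0
    have := ((h1.mul (hU0.const_add 1)).const_sub 1).const_mul L
    simpa using this
  have hrho : Tendsto (fun e => R (e+3) / v (e+2)) atTop (𝓝 L) :=
    tendsto_of_tendsto_of_tendsto_of_le_of_le hLo0
      ((tendsto_add_atTop_iff_nat 1).2 hU0) hLo (fun e => hU (e+1))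
  have hr2 : Tendsto (fun e => r (e+2)) atTop (𝓝 0) := (tendsto_add_atTop_iff_nat 2).2 hr0
  have hfin : Tendsto (fun e => (R (e+3) / v (e+2)) / (L * (1 - r (e+2)))) atTop (𝓝 1) := by
    have := hrho.div ((hr2.const_sub 1).const_mul L) (by simpa using hL.ne')
    rw [sub_zero, mul_one, div_self hL.ne'] at this
    exact this
  refine hfin.congr fun e => ?_
  have h2 := hv (e+2)
  have h3 := hv (e+3)
  have hlt : r (e+2) < 1 := (hrb _).trans_lt (pow_lt_one₀ (by norm_num) (by norm_num) (by omega))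
  have hre : r (e+2) = v (e+2) / v (e+3) := hr _
  have hN3 : N (e+3) = v (e+3) * (1 - r (e+2)) := by
    rw [hN (e+2), hre]; field_simp
  have hNpos : 0 < 1 - r (e+2) := by linarith
  have hN0 : N (e+3) ≠ 0 := by rw [hN3]; positivity
  have h5 : 1 - I (e+3) / N (e+3) = R (e+3) / N (e+3) := by
    rw [hI]; field_simp; ring
  have h6 : v (e+2) = r (e+2) * v (e+3) := by rw [hre]; field_simp
  have h7 := hrpos (e+2)
  rw [h5, hN3, h6]
  field_simp

end IrrProp



/-- For `m ≥ 2` variables, with `N d` the number of polynomials in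
`F[x₁,…,x_m]` of total degree exactly `d` and `I d` the number of irreducible ones,
`1 - I d / N d ~ ((q^(m+1) - q)/(q - 1)) / q^C(m+d-1, m-1)` as `d → ∞`. -/
theorem irreducible_proportion_m_vars (F : Type*) [Field F] [Fintype F]
    (q : ℕ) (hq : q = Fintype.card F) (m : ℕ) (hm : 2 ≤ m)
    (N I : ℕ → ℕ)
    (hN : ∀ d, N d = Set.ncard {f : MvPolynomial (Fin m) F | f.totalDegree = d})
    (hI : ∀ d, I d = Set.ncard
      {f : MvPolynomial (Fin m) F | f.totalDegree = d ∧ Irreducible f}) :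
    Asymptotics.IsEquivalent Filter.atTop
      (fun d : ℕ => 1 - (I d : ℝ) / (N d : ℝ))
      (fun d : ℕ => (((q : ℝ) ^ (m + 1) - (q : ℝ)) / ((q : ℝ) - 1)) *
        (1 / (q : ℝ) ^ Nat.choose (m + d - 1) (m - 1))) := by

  have hq2 : 2 ≤ q := by rw [hq]; exact Fintype.one_lt_card
  have hq2' : (2 : ℝ) ≤ q := by exact_mod_cast hq2
  have hq0 : (0 : ℝ) < q := by linarith
  have hq1 : (0 : ℝ) < (q : ℝ) - 1 := by linarith
  have hm1 : 1 ≤ m := by omega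
  have hT : (((q : ℝ) ^ (m + 1) - (q : ℝ)) / ((q : ℝ) - 1)) = ((IrrProp.T F m).ncard : ℝ) := by
    have h1 := IrrProp.T_ncard (F := F) (m := m)
    have h2 := IrrProp.Dg_ncard_succ (F := F) (m := m) 0
    rw [zero_add, ← h1, ← hq] at h2
    have hb0 : IrrProp.b m 0 = 1 := by simp [IrrProp.b]
    have hb1 : IrrProp.b m 1 = m + 1 := by simp [IrrProp.b, add_comm 1 m]
    rw [hb0, hb1] at h2
    have h3 : (((q - 1 : ℕ) : ℝ)) * ((IrrProp.T F m).ncard : ℝ) + (q : ℝ) ^ 1 = (q : ℝ) ^ (m+1) := by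
      exact_mod_cast h2
    rw [Nat.cast_sub (by omega)] at h3
    rw [div_eq_iff hq1.ne', ← h3]
    push_cast
    ring
  have hLpos : 0 < (((q : ℝ) ^ (m + 1) - (q : ℝ)) / ((q : ℝ) - 1)) := by
    refine div_pos ?_ hq1
    have : (q : ℝ) ^ 1 < (q : ℝ) ^ (m + 1) := pow_lt_pow_right₀ (by linarith) (by omega)
    rw [pow_one] at this
    linarith
  rw [hT] at hLpos ⊢
  have hN' : ∀ d, N d = (IrrProp.Dg F m d).ncard := hN
  have hI' : ∀ d, I d = (IrrProp.Ir F m d).ncard := hI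
  have hrr : ∀ e : ℕ, (1 : ℝ) / (q : ℝ) ^ (e + m).choose (m - 1) =
      (q : ℝ) ^ IrrProp.b m e / (q : ℝ) ^ IrrProp.b m (e+1) := by
    intro e
    rw [IrrProp.b_succ hm1, pow_add]
    field_simp
  have main := IrrProp.analytic (fun d => (q : ℝ) ^ IrrProp.b m d) (fun d => ((IrrProp.Rd F m d).ncard : ℝ))
    (fun d => (N d : ℝ)) (fun d => (I d : ℝ)) (fun e => 1 / (q : ℝ) ^ (e + m).choose (m - 1))
    ((IrrProp.T F m).ncard : ℝ) ((q : ℝ) ^ IrrProp.b m 2) hLpos (fun d => by positivity) hrr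
    (fun e => by
      rw [one_div_pow]
      refine one_div_le_one_div_of_le (by positivity) ?_
      calc (2 : ℝ) ^ (e+2) ≤ (q : ℝ) ^ (e+2) := pow_le_pow_left₀ (by norm_num) hq2' _
        _ ≤ _ := pow_le_pow_right₀ (by linarith) (IrrProp.delta_ge hm e))
    (fun d => by
      have := IrrProp.Dg_ncard_succ (F := F) (m := m) d
      rw [← hq, ← hN'] at this
      rw [eq_sub_iff_add_eq]
      exact_mod_cast this)
    (fun d => by
      have := IrrProp.Ir_add_Rd (F := F) (m := m) d
      rw [← hN', ← hI'] at this
      rw [eq_sub_iff_add_eq]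
      exact_mod_cast this)
    (fun e => by
      have := IrrProp.upper' (F := F) (m := m) hm1 e
      rw [← hq] at this
      exact_mod_cast this)
    (fun d hd => by
      have := IrrProp.lower (F := F) (m := m) hd
      rw [← hI'] at this
      exact_mod_cast this)
  rw [Asymptotics.isEquivalent_iff_tendsto_one
    (Filter.Eventually.of_forall fun d => by positivity)]
  rw [← Filter.tendsto_add_atTop_iff_nat 3]
  refine main.congr fun d => ?_
  simp only [Pi.div_apply]
  rw [show m + (d + 3) - 1 = d + 2 + m by omega]
end

section
/- Let F be a finite field with q elements. Let N₁(d) = q^{d+1} − q^d be the number of polynomials in F[x] of degree exactly d, and let I₁(d) be the number of irreducible polynomials in F[x] of degree exactly d. Then, as d → ∞, the sequence I₁(d)/N₁(d) is asymptotically equivalent to 1/d; in particular the proportion of irreducible polynomials of degree d among all polynomials of degree d tends to 0. -/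
open Polynomial in
lemma irr_aux_finite (F : Type*) [Field F] [Fintype F] (d : ℕ) :
    {f : Polynomial F | f.natDegree = d ∧ Irreducible f}.Finite := by
  have : Finite (degreeLT F (d + 1)) :=
    Finite.of_equiv _ (degreeLTEquiv F (d + 1)).toEquiv.symm
  refine Set.Finite.subset (Set.toFinite (degreeLT F (d + 1) : Set F[X])) ?_
  rintro f ⟨hf, hi⟩
  rw [SetLike.mem_coe, mem_degreeLT, ← natDegree_lt_iff_degree_lt hi.ne_zero]
  omega

open Polynomial in
lemma irr_aux_count (F : Type*) [Field F] [Fintype F] (d : ℕ) (hd : d ≠ 0) :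
    ∃ A : ℕ, Set.ncard {f : Polynomial F | f.natDegree = d ∧ Irreducible f} * d
      = A * (Fintype.card F - 1) ∧ A ≤ Fintype.card F ^ d ∧
      Fintype.card F ^ d ≤ A + d * Fintype.card F ^ (d / 2) := by
  classical
  obtain ⟨p, hp⟩ := CharP.exists F
  have : Fact (Nat.Prime p) := ⟨CharP.char_is_prime F p⟩
  have : NeZero d := ⟨hd⟩
  let E := FiniteField.Extension F p d
  let _ : Fintype E := Fintype.ofFinite E
  have hrank : Module.finrank F E = d := FiniteField.finrank_extension F p d
  have hcard : Fintype.card E = Fintype.card F ^ d := by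
    rw [← Nat.card_eq_fintype_card, ← Nat.card_eq_fintype_card]
    exact FiniteField.natCard_extension F p d
  have hint : ∀ a : E, IsIntegral F a := fun a => Algebra.IsIntegral.isIntegral a
  have hq1 : 1 < Fintype.card F := Fintype.one_lt_card
  let S : Finset E := Finset.univ.filter (fun a => (minpoly F a).natDegree = d)
  have hfin := irr_aux_finite F d
  let T : Finset F[X] := hfin.toFinset
  have hmemT : ∀ f, f ∈ T ↔ f.natDegree = d ∧ Irreducible f := by
    intro f; simp [T]
  -- associates
  have hassoc : ∀ (f : F[X]) (a : E), Irreducible f → aeval a f = 0 →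
      ∃ u : Fˣ, f = C (u : F) * minpoly F a := by
    intro f a hf h
    have h1 := minpoly.eq_of_irreducible hf h
    have hl : f.leadingCoeff ≠ 0 := leadingCoeff_ne_zero.mpr hf.ne_zero
    refine ⟨Units.mk0 _ hl, ?_⟩
    rw [← h1, Units.val_mk0, mul_left_comm, ← C_mul, mul_inv_cancel₀ hl]; simp
  have hdeg : ∀ (a : E) (u : Fˣ), (C (u : F) * minpoly F a).natDegree
      = (minpoly F a).natDegree := fun a u => natDegree_C_mul u.ne_zero
  refine ⟨S.card, ?_, ?_, ?_⟩
  · rw [Set.ncard_eq_toFinset_card _ hfin]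
    change T.card * d = _
    refine (Finset.card_mul_eq_card_mul (s := S) (t := T)
      (fun a f => aeval a f = 0) ?_ ?_).symm
    · intro a ha
      have ha : (minpoly F a).natDegree = d := by simpa [S] using ha
      have : T.bipartiteAbove (fun a f => aeval a f = 0) a
          = Finset.univ.image (fun u : Fˣ => C (u : F) * minpoly F a) := by
        ext f
        simp only [Finset.mem_bipartiteAbove, hmemT, Finset.mem_image, Finset.mem_univ, true_and]
        constructor
        · rintro ⟨⟨_, h2⟩, h3⟩
          obtain ⟨u, hu⟩ := hassoc f a h2 h3
          exact ⟨u, hu.symm⟩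
        · rintro ⟨u, rfl⟩
          refine ⟨⟨(hdeg a u).trans ha, ?_⟩, by simp⟩
          exact (irreducible_isUnit_mul (isUnit_C.mpr u.isUnit)).mpr (minpoly.irreducible (hint a))
      rw [this, Finset.card_image_of_injective, Finset.card_univ, Fintype.card_units]
      intro u v huv
      exact Units.ext (C_injective (mul_right_cancel₀ (minpoly.ne_zero (hint a)) huv))
    · intro f hf
      obtain ⟨hfd, hfi⟩ := (hmemT f).mp hf
      have : S.bipartiteBelow (fun a f => aeval a f = 0) f = (f.rootSet E).toFinset := by
        ext a
        simp only [Finset.mem_bipartiteBelow, Set.mem_toFinset, mem_rootSet, S,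
          Finset.mem_filter, Finset.mem_univ, true_and]
        constructor
        · rintro ⟨_, h⟩; exact ⟨hfi.ne_zero, h⟩
        · rintro ⟨_, h⟩
          refine ⟨?_, h⟩
          obtain ⟨u, hu⟩ := hassoc f a hfi h
          rw [← hdeg a u, ← hu, hfd]
      rw [this, Set.toFinset_card, card_rootSet_eq_natDegree, hfd]
      · exact PerfectField.separable_of_irreducible hfi
      · have h1 : f ∣ X ^ (Nat.card F) ^ d - X :=
          hfi.natDegree_dvd_iff_dvd_X_pow_card_pow_sub_X.mp (hfd ▸ dvd_rfl)
        refine Splits.of_dvd ?_ ?_ (map_dvd (algebraMap F E) h1)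
        · exact IsSplittingField.splits E (X ^ (Nat.card F) ^ d - X)
        · exact map_ne_zero (FiniteField.X_pow_card_pow_sub_X_ne_zero _ hd Finite.one_lt_card)
  · rw [← hcard]; exact Finset.card_le_univ _
  · -- complement
    let B : ℕ → Finset E := fun k => Finset.univ.filter (fun a => a ^ Fintype.card F ^ k = a)
    have hB : ∀ k, k ≠ 0 → (B k).card ≤ Fintype.card F ^ k := by
      intro k hk
      have hne := FiniteField.X_pow_card_pow_sub_X_ne_zero E hk hq1
      have hsub : B k ⊆ (X ^ Fintype.card F ^ k - X : E[X]).roots.toFinset := by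
        intro a ha
        have ha : a ^ Fintype.card F ^ k = a := by simpa [B] using ha
        rw [Multiset.mem_toFinset, mem_roots hne]
        simp [ha]
      calc (B k).card ≤ _ := Finset.card_le_card hsub
        _ ≤ _ := Multiset.toFinset_card_le _
        _ ≤ _ := card_roots' _
        _ = _ := FiniteField.X_pow_card_pow_sub_X_natDegree_eq E hk hq1
    have hsub : (Finset.univ : Finset E) ⊆ S ∪ (Finset.Icc 1 (d / 2)).biUnion B := by
      intro a _
      by_cases h : (minpoly F a).natDegree = d
      · exact Finset.mem_union_left _ (by simp [S, h])
      · refine Finset.mem_union_right _ ?_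
        have hi := minpoly.irreducible (hint a)
        have hdvd : (minpoly F a).natDegree ∣ d := by
          have := minpoly.degree_dvd (hint a)
          rwa [hrank] at this
        have hpos := hi.natDegree_pos
        rw [Finset.mem_biUnion]
        refine ⟨(minpoly F a).natDegree, ?_, ?_⟩
        · rw [Finset.mem_Icc]
          refine ⟨hpos, ?_⟩
          obtain ⟨c, hc⟩ := hdvd
          rw [Nat.le_div_iff_mul_le (by norm_num)]
          have hc2 : 2 ≤ c := by
            rcases c with _ | _ | c
            · simp at hc; omega
            · simp at hc; omega
            · omega
          calc _ ≤ (minpoly F a).natDegree * c := Nat.mul_le_mul_left _ hc2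
            _ = d := hc.symm
        · have h1 := hi.natDegree_dvd_iff_dvd_X_pow_card_pow_sub_X.mp dvd_rfl
          have h2 := (minpoly.dvd_iff).mp h1
          rw [Nat.card_eq_fintype_card] at h2
          simp only [map_sub, map_pow, aeval_X] at h2
          simpa [B] using sub_eq_zero.mp h2
    rw [← hcard, ← Finset.card_univ (α := E)]
    refine (Finset.card_le_card hsub).trans ((Finset.card_union_le _ _).trans ?_)
    refine Nat.add_le_add_left ?_ _
    refine Finset.card_biUnion_le.trans ?_
    have : ∀ k ∈ Finset.Icc 1 (d / 2), (B k).card ≤ Fintype.card F ^ (d / 2) := by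
      intro k hk
      rw [Finset.mem_Icc] at hk
      exact (hB k (by omega)).trans (Nat.pow_le_pow_right (by omega) hk.2)
    refine (Finset.sum_le_card_nsmul _ _ _ this).trans ?_
    rw [smul_eq_mul, Nat.card_Icc]
    exact Nat.mul_le_mul_right _ (by omega)

lemma irr_aux_lim (q : ℕ) (hq : 1 < q) (r : ℕ → ℝ)
    (h : ∀ d, d ≠ 0 → ∃ A : ℕ, r d = A / (q : ℝ) ^ d ∧ A ≤ q ^ d ∧
      q ^ d ≤ A + d * q ^ (d / 2)) :
    Filter.Tendsto r Filter.atTop (nhds 1) := by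
  have hs : (1 : ℝ) < Real.sqrt 2 := by
    rw [Real.lt_sqrt] <;> norm_num
  have ht := tendsto_pow_const_div_const_pow_of_one_lt 1 hs
  have hl : Filter.Tendsto (fun d : ℕ => 1 - (d : ℝ) ^ 1 / (Real.sqrt 2) ^ d)
      Filter.atTop (nhds 1) := by simpa using ht.const_sub 1
  have hq2 : (2 : ℝ) ≤ q := by exact_mod_cast hq
  refine tendsto_of_tendsto_of_tendsto_of_le_of_le' hl tendsto_const_nhds ?_ ?_
  · filter_upwards [Filter.eventually_ne_atTop 0] with d hd
    obtain ⟨A, h1, h2, h3⟩ := h d hd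
    have h3' : (q : ℝ) ^ d ≤ A + d * (q : ℝ) ^ (d / 2) := by exact_mod_cast h3
    have hpos : (0 : ℝ) < (q : ℝ) ^ d := by positivity
    have key : (q : ℝ) ^ (d / 2) * Real.sqrt 2 ^ d ≤ (q : ℝ) ^ d := by
      have e1 : Real.sqrt 2 ^ d ≤ (q : ℝ) ^ (d - d / 2) := by
        calc Real.sqrt 2 ^ d ≤ Real.sqrt 2 ^ (2 * (d - d / 2)) :=
              pow_le_pow_right₀ hs.le (by omega)
          _ = 2 ^ (d - d / 2) := by rw [pow_mul, Real.sq_sqrt (by norm_num)]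
          _ ≤ _ := pow_le_pow_left₀ (by norm_num) hq2 _
      calc _ ≤ (q : ℝ) ^ (d / 2) * (q : ℝ) ^ (d - d / 2) := by gcongr
        _ = _ := by rw [← pow_add]; congr 1; omega
    have hsp : (0 : ℝ) < Real.sqrt 2 ^ d := by positivity
    have k2 : (q : ℝ) ^ (d / 2) ≤ (q : ℝ) ^ d / Real.sqrt 2 ^ d := by
      rwa [le_div_iff₀ hsp]
    rw [h1, le_div_iff₀ hpos]
    have k3 : (d : ℝ) * (q : ℝ) ^ (d / 2) ≤ d * ((q : ℝ) ^ d / Real.sqrt 2 ^ d) := by gcongr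
    have k4 : (1 - (d : ℝ) ^ 1 / Real.sqrt 2 ^ d) * (q : ℝ) ^ d
      = (q : ℝ) ^ d - d * ((q : ℝ) ^ d / Real.sqrt 2 ^ d) := by ring
    linarith
  · filter_upwards [Filter.eventually_ne_atTop 0] with d hd
    obtain ⟨A, h1, h2, h3⟩ := h d hd
    have hpos : (0 : ℝ) < (q : ℝ) ^ d := by positivity
    rw [h1, div_le_one hpos]
    exact_mod_cast h2


/-- In one variable, with `N d = q^(d+1) - q^d` the number of
polynomials of degree exactly `d` and `I d` the number of irreducible polynomials of
degree exactly `d`, `I d / N d ~ 1/d` as `d → ∞`; in particular `I d / N d → 0`. -/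
theorem irreducible_proportion_one_var (F : Type*) [Field F] [Fintype F]
    (q : ℕ) (hq : q = Fintype.card F)
    (N I : ℕ → ℕ)
    (hN : ∀ d, N d = q ^ (d + 1) - q ^ d)
    (hI : ∀ d, I d = Set.ncard
      {f : Polynomial F | f.natDegree = d ∧ Irreducible f}) :
    Asymptotics.IsEquivalent Filter.atTop
      (fun d : ℕ => (I d : ℝ) / (N d : ℝ))
      (fun d : ℕ => 1 / (d : ℝ)) ∧
    Filter.Tendsto (fun d : ℕ => (I d : ℝ) / (N d : ℝ)) Filter.atTop (nhds 0) := by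
  have hq1 : 1 < q := hq ▸ Fintype.one_lt_card
  have hlim : Filter.Tendsto (fun d : ℕ => ((I d : ℝ) / (N d : ℝ)) * d) Filter.atTop (nhds 1) := by
    refine irr_aux_lim q hq1 _ ?_
    intro d hd
    obtain ⟨A, h1, h2, h3⟩ := irr_aux_count F d hd
    rw [← hI d, ← hq] at h1
    rw [← hq] at h2 h3
    refine ⟨A, ?_, h2, h3⟩
    have hNd : (N d : ℝ) = (q : ℝ) ^ d * ((q : ℝ) - 1) := by
      rw [hN d, Nat.cast_sub (Nat.pow_le_pow_right (by omega) (by omega))]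
      push_cast; ring
    have h1' : (I d : ℝ) * d = A * ((q : ℝ) - 1) := by
      have : ((I d * d : ℕ) : ℝ) = ((A * (q - 1) : ℕ) : ℝ) := by rw [h1]
      rw [Nat.cast_mul, Nat.cast_mul, Nat.cast_sub hq1.le] at this
      simpa using this
    have hqr : (1 : ℝ) < q := by exact_mod_cast hq1
    have hpos : (0 : ℝ) < (q : ℝ) ^ d := by positivity
    have hne : (q : ℝ) - 1 ≠ 0 := by linarith
    rw [div_mul_eq_mul_div, h1', hNd, mul_div_mul_right _ _ hne]
  have heq : Asymptotics.IsEquivalent Filter.atTop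
      (fun d : ℕ => (I d : ℝ) / (N d : ℝ)) (fun d : ℕ => 1 / (d : ℝ)) := by
    rw [Asymptotics.isEquivalent_iff_tendsto_one]
    · refine hlim.congr ?_
      intro d
      simp
    · filter_upwards [Filter.eventually_ne_atTop 0] with d hd
      have : (d : ℝ) ≠ 0 := by exact_mod_cast hd
      positivity
  exact ⟨heq, heq.symm.tendsto_nhds tendsto_one_div_atTop_nhds_zero_nat⟩
end
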